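/- arXiv:1606.05061 — 4 statements merged into one kernel-verified Lean document; each statement's English description precedes it below -/
import Mathlib

section
/- Perfect embezzlement of a Bell state is possible in the commuting operator framework with a separable resource space: there exist a unit vector ψ ∈ ℓ²(ℕ), unitary operators U_A on ℓ²(Fin 2 × ℕ) and U_B on ℓ²(ℕ × Fin 2), and unitary operators W_A and W_B on K := ℓ²(Fin 2 × ℕ × Fin 2) such that: (1) for every f ∈ K and every j ∈ Fin 2, the slice (i,n) ↦ (W_A f)(i,n,j), which lies in ℓ²(Fin 2 × ℕ), equals U_A applied to the slice (i,n) ↦ f(i,n,j); (2) for every f ∈ K and every i ∈ Fin 2, the slice (n,j) ↦ (W_B f)(i,n,j) equals U_B applied to the slice (n,j) ↦ f(i,n,j); (3) W_A ∘ W_B = W_B ∘ W_A; and (4) W_A (W_B z) = w, where z, w ∈ K are the vectors with coordinates z(i,n,j) = (if i = 0 ∧ j = 0 then ψ n else 0) and w(i,n,j) = (if i = j then (1/√2) * ψ n else 0). -/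
/-- `ℓ²(X)`: the Hilbert space of square-summable families of complex numbers indexed by `X`. -/
noncomputable abbrev l2 (X : Type*) := lp (fun _ : X => ℂ) 2

section GateConstruction

/-- A permutation composed with a real symmetric involution which mixes each index `y` only with
its partner `τ y`. -/
structure Gate (Y : Type*) where
  /-- the permutation of the index set -/
  σ : Equiv.Perm Y
  /-- the partner of an index -/
  τ : Y → Y
  /-- the diagonal coefficients of the involution -/
  a : Y → ℝ
  /-- the off-diagonal coefficients of the involution -/
  b : Y → ℝ
  τ_τ : ∀ y, τ (τ y) = y
  b_τ : ∀ y, b (τ y) = b y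
  sq_add_sq : ∀ y, a y ^ 2 + b y ^ 2 = 1
  add_mul_b : ∀ y, (a y + a (τ y)) * b y = 0

namespace Gate

variable {Y : Type*} (G : Gate Y)

/-- The involution of a gate, acting on arbitrary families. -/
def mix (f : Y → ℂ) (y : Y) : ℂ := G.a y * f y + G.b y * f (G.τ y)

/-- The action of a gate on arbitrary families. -/
def act (f : Y → ℂ) (y : Y) : ℂ := G.mix f (G.σ y)

lemma mix_mix (f : Y → ℂ) : G.mix (G.mix f) = f := by
  funext y
  have h1 : (G.a y : ℂ) ^ 2 + (G.b y : ℂ) ^ 2 = 1 := by exact_mod_cast G.sq_add_sq y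
  have h2 : ((G.a y : ℂ) + G.a (G.τ y)) * G.b y = 0 := by exact_mod_cast G.add_mul_b y
  simp only [mix, G.τ_τ, G.b_τ]
  linear_combination f y * h1 + f (G.τ y) * h2

/-- Partnership as a permutation. -/
def τEquiv : Equiv.Perm Y := ⟨G.τ, G.τ, G.τ_τ, G.τ_τ⟩

lemma sq_mix_add (f : Y → ℂ) (y : Y) :
    ‖G.mix f y‖ ^ 2 + ‖G.mix f (G.τ y)‖ ^ 2 = ‖f y‖ ^ 2 + ‖f (G.τ y)‖ ^ 2 := by
  have h1 := G.sq_add_sq y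
  have h2 := G.add_mul_b y
  have h3 := G.sq_add_sq (G.τ y)
  rw [G.b_τ] at h3
  simp only [mix, G.τ_τ, G.b_τ, Complex.sq_norm, Complex.normSq_apply, Complex.add_re,
    Complex.add_im, Complex.mul_re, Complex.mul_im, Complex.ofReal_re, Complex.ofReal_im]
  linear_combination ((f y).re ^ 2 + (f y).im ^ 2) * h1
    + ((f (G.τ y)).re ^ 2 + (f (G.τ y)).im ^ 2) * h3
    + 2 * ((f y).re * (f (G.τ y)).re + (f y).im * (f (G.τ y)).im) * h2

lemma summable_mix {f : Y → ℂ} (hf : Summable fun y => ‖f y‖ ^ 2) :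
    Summable fun y => ‖G.mix f y‖ ^ 2 := by
  have hτ : Summable fun y => ‖f (G.τ y)‖ ^ 2 := G.τEquiv.summable_iff.mpr hf
  refine Summable.of_nonneg_of_le (fun y => by positivity) (fun y => ?_) (hf.add hτ)
  have := G.sq_mix_add f y
  nlinarith [sq_nonneg ‖G.mix f (G.τ y)‖]

lemma tsum_mix {f : Y → ℂ} (hf : Summable fun y => ‖f y‖ ^ 2) :
    ∑' y, ‖G.mix f y‖ ^ 2 = ∑' y, ‖f y‖ ^ 2 := by
  have key : ∀ {g : Y → ℝ}, Summable g → ∑' y, (g y + g (G.τ y)) = 2 * ∑' y, g y := by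
    intro g hg
    have hτ : Summable fun y => g (G.τ y) := G.τEquiv.summable_iff.mpr hg
    have he : ∑' y, g (G.τ y) = ∑' y, g y := G.τEquiv.tsum_eq g
    rw [hg.tsum_add hτ, he, two_mul]
  have h := key (G.summable_mix hf)
  simp only [G.sq_mix_add] at h
  rw [key (g := fun y => ‖f y‖ ^ 2) hf] at h
  linarith

end Gate

lemma l2_memℓp_iff {Y : Type*} (f : Y → ℂ) :
    Memℓp f 2 ↔ Summable fun y => ‖f y‖ ^ 2 := by
  rw [memℓp_gen_iff (by norm_num)]
  norm_num

lemma l2_norm_sq {Y : Type*} (f : l2 Y) : ‖f‖ ^ 2 = ∑' y, ‖f y‖ ^ 2 := by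
  have := lp.norm_rpow_eq_tsum (p := 2) (by norm_num) f
  simpa using this

namespace Gate

variable {Y : Type*} (G : Gate Y)

lemma summable_act {f : Y → ℂ} (hf : Summable fun y => ‖f y‖ ^ 2) :
    Summable fun y => ‖G.act f y‖ ^ 2 :=
  G.σ.summable_iff.mpr (G.summable_mix hf)

/-- The unitary operator of a gate. -/
noncomputable def unitary : l2 Y ≃ₗᵢ[ℂ] l2 Y :=
  LinearIsometryEquiv.ofSurjective
    { toFun := fun f => ⟨G.act f,
        (l2_memℓp_iff _).mpr (G.summable_act ((l2_memℓp_iff _).mp (lp.memℓp f)))⟩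
      map_add' := fun f g => by
        ext y
        simp only [act, mix, lp.coeFn_add, Pi.add_apply]
        ring
      map_smul' := fun c f => by
        ext y
        simp only [act, mix, lp.coeFn_smul, Pi.smul_apply, smul_eq_mul, RingHom.id_apply]
        ring
      norm_map' := fun f => by
        rw [← sq_eq_sq₀ (norm_nonneg _) (norm_nonneg _), l2_norm_sq, l2_norm_sq,
          ← G.tsum_mix ((l2_memℓp_iff _).mp (lp.memℓp f))]
        exact G.σ.tsum_eq fun y => ‖G.mix f y‖ ^ 2 }
    (fun g => by
      refine ⟨⟨G.mix fun y => g (G.σ.symm y), (l2_memℓp_iff _).mpr (G.summable_mix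
        (G.σ.symm.summable_iff.mpr ((l2_memℓp_iff _).mp (lp.memℓp g))))⟩, ?_⟩
      ext y
      change G.mix (G.mix fun y => g (G.σ.symm y)) (G.σ y) = g y
      rw [mix_mix, Equiv.symm_apply_apply])

lemma unitary_apply (f : l2 Y) (y : Y) : G.unitary f y = G.act f y := rfl

/-- A gate acting on the first factor of a product. -/
def pullback {Y' J : Type*} (e : Y' ≃ Y × J) : Gate Y' where
  σ := (e.trans (G.σ.prodCongr (Equiv.refl J))).trans e.symm
  τ y := e.symm (G.τ (e y).1, (e y).2)
  a y := G.a (e y).1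
  b y := G.b (e y).1
  τ_τ y := by simp [G.τ_τ]
  b_τ y := by simp [G.b_τ]
  sq_add_sq y := G.sq_add_sq _
  add_mul_b y := by simpa using G.add_mul_b _

lemma act_pullback {Y' J : Type*} (e : Y' ≃ Y × J) (f : Y' → ℂ) (y : Y') :
    (G.pullback e).act f y = G.act (fun x => f (e.symm (x, (e y).2))) (e y).1 := by
  simp [act, mix, pullback, Prod.map]

end Gate

end GateConstruction

section Registers

open Polynomial

lemma inv_sqrt_two_sq : (1 / √2 : ℝ) ^ 2 = 1 / 2 := by
  rw [div_pow, Real.sq_sqrt zero_le_two, one_pow]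

/-- A finitely supported string of bits, as a polynomial. -/
abbrev Bits := (ZMod 2)[X]

/-- Prepending a bit to a string. -/
noncomputable def Bits.push (p : ZMod 2) (w : Bits) : Bits := X * w + C p

namespace Bits

@[simp] lemma coeff_push_zero (p : ZMod 2) (w : Bits) : (push p w).coeff 0 = p := by
  simp [push]

@[simp] lemma coeff_push_succ (p : ZMod 2) (w : Bits) (n : ℕ) :
    (push p w).coeff (n + 1) = w.coeff n := by
  simp [push]

@[simp] lemma divX_push (p : ZMod 2) (w : Bits) : (push p w).divX = w := by
  ext n
  simp [coeff_divX]

@[simp] lemma push_divX (w : Bits) : push (w.coeff 0) w.divX = w := by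
  rw [push, X_mul, divX_mul_X_add]

@[simp] lemma add_monomial_add_monomial (w : Bits) (n : ℕ) (p : ZMod 2) :
    w + monomial n p + monomial n p = w := by
  rw [add_assoc, CharTwo.add_self_eq_zero, add_zero]

lemma push_add_monomial (p q : ZMod 2) (w : Bits) (n : ℕ) :
    push p (w + monomial n q) = push p w + monomial (n + 1) q := by
  rw [push, push, mul_add, X_mul_monomial]
  ring

lemma push_eq_zero {p : ZMod 2} {w : Bits} : push p w = 0 ↔ p = 0 ∧ w = 0 := by
  constructor
  · intro h
    have h0 := coeff_push_zero p w
    have h1 := divX_push p w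
    rw [h] at h0 h1
    exact ⟨by simpa using h0.symm, by simpa using h1.symm⟩
  · rintro ⟨rfl, rfl⟩
    simp [push]

lemma push_add_C (p q : ZMod 2) (w : Bits) : push p w + C q = push (p + q) w := by
  rw [push, push, C_add, add_assoc]

end Bits

/-- The resource register `(k, w, s, m, n)`. The integer `k` is the excess of the number of
unpaired qubits of Alice over that of Bob; the string `w` starts with the unpaired qubits and
continues with the parities of the entangled pairs, the phases of which are recorded by `s`.
The strings `m` and `n` hold the ancilla qubits consumed by Alice and by Bob. -/
abbrev Register := ℤ × Bits × Bits × Bits × Bits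

/-- Coefficient on the diagonal of the Hadamard matrix. -/
noncomputable def hadamardDiag (p : ZMod 2) : ℝ := if p = 0 then 1 / √2 else -(1 / √2)

lemma hadamardDiag_sq (p : ZMod 2) : hadamardDiag p ^ 2 = 1 / 2 := by
  rw [← inv_sqrt_two_sq, hadamardDiag]
  split_ifs <;> ring

lemma hadamardDiag_add_one (p : ZMod 2) : hadamardDiag p + hadamardDiag (p + 1) = 0 := by
  have h : p = 0 ∨ p = 1 := by revert p; decide
  rcases h with rfl | rfl
  · simp [hadamardDiag]
  · simp [hadamardDiag, CharTwo.add_self_eq_zero]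

/-- The gate applying a Hadamard matrix to the first phase bit of the register in the sectors `k`
with `P k`, followed by a permutation. -/
noncomputable def hadamardGate (P : ℤ → Prop) [DecidablePred P]
    (σ : Equiv.Perm (ZMod 2 × Register)) : Gate (ZMod 2 × Register) where
  σ := σ
  τ := fun (i, k, w, s, m, n) => (i, k, w, s + C 1, m, n)
  a := fun (_, k, _, s, _, _) => if P k then hadamardDiag (s.coeff 0) else 1
  b := fun (_, k, _, _, _, _) => if P k then 1 / √2 else 0
  τ_τ := fun (i, k, w, s, m, n) => by
    simp only [add_assoc, CharTwo.add_self_eq_zero, add_zero]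
  b_τ := fun (i, k, w, s, m, n) => rfl
  sq_add_sq := fun (i, k, w, s, m, n) => by
    dsimp only
    split_ifs
    · rw [hadamardDiag_sq, inv_sqrt_two_sq]; norm_num
    · norm_num
  add_mul_b := fun (i, k, w, s, m, n) => by
    dsimp only
    split_ifs
    · rw [coeff_add, coeff_C_zero, hadamardDiag_add_one, zero_mul]
    · simp

open Bits

/-- Reversal of Alice's move: the emitted qubit `p` returns to the register, and the ancilla
consumed last is released. -/
noncomputable def alicePerm : Equiv.Perm (ZMod 2 × Register) where
  toFun := fun (p, k, w, s, m, n) =>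
    if 0 ≤ k then (m.coeff 0, k + 1, push p w, s, m.divX, n)
    else (m.coeff 0, k + 1, w + monomial (-k - 1).toNat p, push p s, m.divX, n)
  invFun := fun (i, k, w, s, m, n) =>
    if 0 < k then (w.coeff 0, k - 1, w.divX, s, push i m, n)
    else (s.coeff 0, k - 1, w + monomial (-k).toNat (s.coeff 0), s.divX, push i m, n)
  left_inv := fun (p, k, w, s, m, n) => by
    dsimp only
    by_cases hk : 0 ≤ k
    · have hk' : 0 < k + 1 := by omega
      simp [hk, hk']
    · have hk' : ¬ 0 < k + 1 := by omega
      have e : -(k + 1) = -k - 1 := by ring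
      simp only [hk, hk', if_false, coeff_push_zero, divX_push, push_divX, e,
        add_monomial_add_monomial, add_sub_cancel_right]
  right_inv := fun (i, k, w, s, m, n) => by
    dsimp only
    by_cases hk : 0 < k
    · have hk' : 0 ≤ k - 1 := by omega
      simp only [hk, hk', if_true, coeff_push_zero, divX_push, push_divX, sub_add_cancel]
    · have hk' : ¬ 0 ≤ k - 1 := by omega
      have e : -(k - 1) - 1 = -k := by ring
      simp only [hk, hk', if_false, coeff_push_zero, divX_push, push_divX, e,
        add_monomial_add_monomial, sub_add_cancel]

/-- Reversal of Bob's move. -/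
noncomputable def bobPerm : Equiv.Perm (ZMod 2 × Register) where
  toFun := fun (q, k, w, s, m, n) =>
    if k ≤ 0 then (n.coeff 0, k - 1, push q w, s, m, n.divX)
    else (n.coeff 0, k - 1, w + monomial (k - 1).toNat q, push (w.coeff (k - 1).toNat) s, m,
      n.divX)
  invFun := fun (j, k, w, s, m, n) =>
    if k < 0 then (w.coeff 0, k + 1, w.divX, s, m, push j n)
    else (w.coeff k.toNat + s.coeff 0, k + 1,
      w + monomial k.toNat (w.coeff k.toNat + s.coeff 0), s.divX, m, push j n)
  left_inv := fun (q, k, w, s, m, n) => by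
    dsimp only
    by_cases hk : k ≤ 0
    · have hk' : k - 1 < 0 := by omega
      simp [hk, hk']
    · have hk' : ¬ k - 1 < 0 := by omega
      have e : ∀ x : ZMod 2, x + q + x = q := fun x => by
        rw [add_right_comm, CharTwo.add_self_eq_zero, zero_add]
      simp only [hk, hk', if_false, coeff_push_zero, divX_push, push_divX, coeff_add,
        coeff_monomial_same, e, add_monomial_add_monomial, sub_add_cancel]
  right_inv := fun (j, k, w, s, m, n) => by
    dsimp only
    by_cases hk : k < 0
    · have hk' : k + 1 ≤ 0 := by omega
      simp [hk, hk']
    · have hk' : ¬ k + 1 ≤ 0 := by omega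
      have e : ∀ x y : ZMod 2, x + (x + y) = y := fun x y => by
        rw [← add_assoc, CharTwo.add_self_eq_zero, zero_add]
      simp only [hk, hk', if_false, coeff_push_zero, divX_push, push_divX, coeff_add,
        coeff_monomial_same, e, add_monomial_add_monomial, add_sub_cancel_right]

/-- Alice's move. -/
noncomputable def aliceGate : Gate (ZMod 2 × Register) := hadamardGate (· ≤ 0) alicePerm

/-- Bob's move. -/
noncomputable def bobGate : Gate (ZMod 2 × Register) := hadamardGate (0 ≤ ·) bobPerm

lemma aliceGate_act_of_nonneg (f : ZMod 2 × Register → ℂ) (p : ZMod 2) {k : ℤ} (hk : 0 ≤ k)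
    (w s m n : Bits) :
    aliceGate.act f (p, k, w, s, m, n) = f (m.coeff 0, k + 1, push p w, s, m.divX, n) := by
  have hk' : ¬ k + 1 ≤ 0 := by omega
  simp [aliceGate, hadamardGate, Gate.act, Gate.mix, alicePerm, hk, hk']

lemma aliceGate_act_of_neg (f : ZMod 2 × Register → ℂ) (p : ZMod 2) {k : ℤ} (hk : k < 0)
    (w s m n : Bits) :
    aliceGate.act f (p, k, w, s, m, n) =
      hadamardDiag p *
          f (m.coeff 0, k + 1, w + monomial (-k - 1).toNat p, push p s, m.divX, n) +
        (1 / √2 : ℝ) *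
          f (m.coeff 0, k + 1, w + monomial (-k - 1).toNat p, push (p + 1) s, m.divX, n) := by
  have hk' : k + 1 ≤ 0 := by omega
  have hk'' : ¬ 0 ≤ k := by omega
  simp only [aliceGate, hadamardGate, Gate.act, Gate.mix, alicePerm, hk', hk'', Equiv.coe_fn_mk,
    if_false, if_true, coeff_push_zero, push_add_C]

lemma bobGate_act_of_nonpos (f : ZMod 2 × Register → ℂ) (q : ZMod 2) {k : ℤ} (hk : k ≤ 0)
    (w s m n : Bits) :
    bobGate.act f (q, k, w, s, m, n) = f (n.coeff 0, k - 1, push q w, s, m, n.divX) := by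
  have hk' : ¬ 0 ≤ k - 1 := by omega
  simp only [bobGate, hadamardGate, Gate.act, Gate.mix, bobPerm, hk, hk', Equiv.coe_fn_mk,
    if_false, if_true, Complex.ofReal_one, Complex.ofReal_zero, one_mul, zero_mul, add_zero]

lemma bobGate_act_of_pos (f : ZMod 2 × Register → ℂ) (q : ZMod 2) {k : ℤ} (hk : 0 < k)
    (w s m n : Bits) :
    bobGate.act f (q, k, w, s, m, n) =
      hadamardDiag (w.coeff (k - 1).toNat) *
          f (n.coeff 0, k - 1, w + monomial (k - 1).toNat q,
            push (w.coeff (k - 1).toNat) s, m, n.divX) +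
        (1 / √2 : ℝ) *
          f (n.coeff 0, k - 1, w + monomial (k - 1).toNat q,
            push (w.coeff (k - 1).toNat + 1) s, m, n.divX) := by
  have hk' : 0 ≤ k - 1 := by omega
  have hk'' : ¬ k ≤ 0 := by omega
  simp only [bobGate, hadamardGate, Gate.act, Gate.mix, bobPerm, hk', hk'', Equiv.coe_fn_mk,
    if_false, if_true, coeff_push_zero, push_add_C]

/-- Alice's move on both qubits and the register. -/
noncomputable def aliceAct (F : ZMod 2 → Register → ZMod 2 → ℂ) (i : ZMod 2) (r : Register)
    (j : ZMod 2) : ℂ :=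
  aliceGate.act (fun x => F x.1 x.2 j) (i, r)

/-- Bob's move on both qubits and the register. -/
noncomputable def bobAct (F : ZMod 2 → Register → ZMod 2 → ℂ) (i : ZMod 2) (r : Register)
    (j : ZMod 2) : ℂ :=
  bobGate.act (fun x => F i x.2 x.1) (j, r)

lemma aliceAct_bobAct_zero (F : ZMod 2 → Register → ZMod 2 → ℂ) (i j : ZMod 2)
    (w s m n : Bits) :
    aliceAct (bobAct F) i (0, w, s, m, n) j =
      hadamardDiag i *
          F (m.coeff 0) (0, push (i + j) w, push i s, m.divX, n.divX) (n.coeff 0) +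
        (1 / √2 : ℝ) *
          F (m.coeff 0) (0, push (i + j) w, push (i + 1) s, m.divX, n.divX) (n.coeff 0) := by
  rw [aliceAct, aliceGate_act_of_nonneg _ _ le_rfl, bobAct,
    bobGate_act_of_pos _ _ (by norm_num)]
  simp [push_add_C]

lemma aliceAct_bobAct (F : ZMod 2 → Register → ZMod 2 → ℂ) (i : ZMod 2) (r : Register)
    (j : ZMod 2) : aliceAct (bobAct F) i r j = bobAct (aliceAct F) i r j := by
  obtain ⟨k, w, s, m, n⟩ := r
  rcases lt_trichotomy k 0 with hk | rfl | hk
  · simp only [aliceAct, bobAct]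
    rw [aliceGate_act_of_neg _ _ hk, bobGate_act_of_nonpos _ _ hk.le]
    dsimp only
    rw [bobGate_act_of_nonpos _ _ (by omega), bobGate_act_of_nonpos _ _ (by omega),
      aliceGate_act_of_neg _ _ (by omega)]
    have e : (-(k - 1) - 1).toNat = (-k - 1).toNat + 1 := by omega
    simp only [push_add_monomial, e, sub_add_cancel, add_sub_cancel_right]
  · rw [aliceAct_bobAct_zero, bobAct, bobGate_act_of_nonpos _ _ le_rfl, aliceAct,
      aliceGate_act_of_neg _ _ (by norm_num)]
    simp [push_add_C, add_comm i j]
  · simp only [aliceAct, bobAct]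
    rw [aliceGate_act_of_nonneg _ _ hk.le, bobGate_act_of_pos _ _ hk]
    dsimp only
    rw [aliceGate_act_of_nonneg _ _ (by omega), aliceGate_act_of_nonneg _ _ (by omega),
      bobGate_act_of_pos _ _ (by omega)]
    have e : k.toNat = (k - 1).toNat + 1 := by omega
    simp only [push_add_monomial, sub_add_cancel, add_sub_cancel_right]
    simp only [e, coeff_push_succ]

lemma coeff_zero_eq_zero_and_divX_eq_zero {m : Bits} :
    (m.coeff 0 = 0 ∧ m.divX = 0) ↔ m = 0 := by
  rw [← push_eq_zero, push_divX]

lemma aliceAct_bobAct_apply_single (F : ZMod 2 → Register → ZMod 2 → ℂ)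
    (hF : ∀ i r j, F i r j = if i = 0 ∧ j = 0 then (if r = 0 then 1 else 0) else 0)
    (i : ZMod 2) (r : Register) (j : ZMod 2) :
    aliceAct (bobAct F) i r j =
      if i = j then ((1 / √2 : ℝ) : ℂ) * (if r = 0 then 1 else 0) else 0 := by
  obtain ⟨k, w, s, m, n⟩ := r
  have hF' : ∀ i k w s m n j, k ≠ 0 → F i (k, w, s, m, n) j = 0 := by
    intro i k w s m n j hk
    simp [hF, hk]
  rcases lt_trichotomy k 0 with hk | rfl | hk
  · rw [aliceAct, aliceGate_act_of_neg _ _ hk]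
    simp only [bobAct]
    rw [bobGate_act_of_nonpos _ _ (by omega), bobGate_act_of_nonpos _ _ (by omega)]
    simp [hF' _ _ _ _ _ _ _ hk.ne, hk.ne]
  · have key : ∀ p q, F (m.coeff 0) (0, push p w, push q s, m.divX, n.divX) (n.coeff 0) =
        if p = 0 ∧ q = 0 then (if ((0, w, s, m, n) : Register) = 0 then 1 else 0) else 0 := by
      intro p q
      rw [hF, ← ite_and, ← ite_and]
      refine if_congr ?_ rfl rfl
      rw [Prod.mk_eq_zero, Prod.mk_eq_zero, Prod.mk_eq_zero, Prod.mk_eq_zero, Prod.mk_eq_zero,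
        Prod.mk_eq_zero, Prod.mk_eq_zero, Prod.mk_eq_zero, push_eq_zero, push_eq_zero,
        ← coeff_zero_eq_zero_and_divX_eq_zero (m := m),
        ← coeff_zero_eq_zero_and_divX_eq_zero (m := n)]
      tauto
    rw [aliceAct_bobAct_zero, key, key]
    have hij : i + j = 0 ↔ i = j := CharTwo.add_eq_zero
    by_cases h : i = j
    · have h2 : ∀ p : ZMod 2, p = 0 ∧ p + 1 ≠ 0 ∨ p ≠ 0 ∧ p + 1 = 0 := by decide
      rcases h2 i with ⟨h0, h1⟩ | ⟨h0, h1⟩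
      · rw [if_pos h, ite_and, ite_and, if_pos (hij.mpr h), if_pos (hij.mpr h), if_pos h0, if_neg h1, hadamardDiag, if_pos h0, mul_zero, add_zero]
      · rw [if_pos h, ite_and, ite_and, if_pos (hij.mpr h), if_pos (hij.mpr h), if_neg h0, if_pos h1, mul_zero, zero_add]
    · simp only [hij, h, false_and, if_false, mul_zero, add_zero]
  · rw [aliceAct, aliceGate_act_of_nonneg _ _ hk.le]
    simp only [bobAct]
    rw [bobGate_act_of_pos _ _ (by omega)]
    simp [hF' _ _ _ _ _ _ _ hk.ne', hk.ne']

lemma nonempty_nat_equiv_register : Nonempty (ℕ ≃ Register) := by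
  have : Countable Bits := by
    have : Countable (ℕ →₀ ZMod 2) := inferInstance
    exact Function.Injective.countable (f := fun w : Bits => w.toFinsupp.coeff)
      (AddMonoidAlgebra.coeff_injective.comp toFinsupp_injective)
  exact nonempty_equiv_of_countable

end Registers

/-- Perfect embezzlement of a Bell state is possible in the commuting operator framework
with a separable resource space `ℓ²(ℕ)`. -/
theorem perfect_embezzlement_commuting_operator :
    ∃ (ψ : l2 ℕ)
      (UA : l2 (Fin 2 × ℕ) ≃ₗᵢ[ℂ] l2 (Fin 2 × ℕ))
      (UB : l2 (ℕ × Fin 2) ≃ₗᵢ[ℂ] l2 (ℕ × Fin 2))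
      (WA WB : l2 (Fin 2 × ℕ × Fin 2) ≃ₗᵢ[ℂ] l2 (Fin 2 × ℕ × Fin 2)),
      ‖ψ‖ = 1 ∧
      -- (1) `WA` acts as `UA` on Alice's qubit together with the resource space:
      (∀ (f : l2 (Fin 2 × ℕ × Fin 2)) (g : l2 (Fin 2 × ℕ)) (j : Fin 2),
        (∀ i n, g (i, n) = f (i, n, j)) → ∀ i n, (WA f) (i, n, j) = (UA g) (i, n)) ∧
      -- (2) `WB` acts as `UB` on the resource space together with Bob's qubit:
      (∀ (f : l2 (Fin 2 × ℕ × Fin 2)) (g : l2 (ℕ × Fin 2)) (i : Fin 2),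
        (∀ n j, g (n, j) = f (i, n, j)) → ∀ n j, (WB f) (i, n, j) = (UB g) (n, j)) ∧
      -- (3) Alice's and Bob's operations commute:
      (∀ f, WA (WB f) = WB (WA f)) ∧
      -- (4) starting from `|0⟩ ⊗ ψ ⊗ |0⟩` the protocol produces a Bell state on the two
      -- qubits while returning the catalyst `ψ` intact:
      (∃ z w : l2 (Fin 2 × ℕ × Fin 2),
        (∀ (i : Fin 2) (n : ℕ) (j : Fin 2),
          z (i, n, j) = if i = 0 ∧ j = 0 then ψ n else 0) ∧
        (∀ (i : Fin 2) (n : ℕ) (j : Fin 2),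
          w (i, n, j) = if i = j then (1 / Real.sqrt 2 : ℂ) * ψ n else 0) ∧
        WA (WB z) = w) := by
  obtain ⟨e⟩ := nonempty_nat_equiv_register
  let c : Fin 2 ≃ ZMod 2 := (ZMod.finEquiv 2).toEquiv
  have hc0 : ∀ i, c i = 0 ↔ i = 0 := fun i => map_eq_zero_iff _ (ZMod.finEquiv 2).injective
  let eA : Fin 2 × ℕ ≃ (ZMod 2 × Register) × Unit := (c.prodCongr e).trans (Equiv.prodPUnit _).symm
  let eB : ℕ × Fin 2 ≃ (ZMod 2 × Register) × Unit :=
    ((e.prodCongr c).trans (Equiv.prodComm _ _)).trans (Equiv.prodPUnit _).symm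
  let eAA : Fin 2 × ℕ × Fin 2 ≃ (ZMod 2 × Register) × ZMod 2 :=
    (c.prodCongr (e.prodCongr c)).trans (Equiv.prodAssoc _ _ _).symm
  let eBB : Fin 2 × ℕ × Fin 2 ≃ (ZMod 2 × Register) × ZMod 2 :=
    (c.prodCongr ((e.prodCongr c).trans (Equiv.prodComm _ _))).trans (Equiv.prodComm _ _)
  let WA := (aliceGate.pullback eAA).unitary
  let WB := (bobGate.pullback eBB).unitary
  let F (f : l2 (Fin 2 × ℕ × Fin 2)) (i : ZMod 2) (r : Register) (j : ZMod 2) : ℂ :=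
    f (c.symm i, e.symm r, c.symm j)
  have hWA : ∀ f i n j, WA f (i, n, j) = aliceAct (F f) (c i) (e n) (c j) := fun f i n j =>
    (Gate.unitary_apply _ _ _).trans (Gate.act_pullback _ _ _ _)
  have hWB : ∀ f i n j, WB f (i, n, j) = bobAct (F f) (c i) (e n) (c j) := fun f i n j =>
    (Gate.unitary_apply _ _ _).trans (Gate.act_pullback _ _ _ _)
  have hFA : ∀ f, F (WA f) = aliceAct (F f) := fun f => by
    funext i r j
    simp only [F, hWA, Equiv.apply_symm_apply]
  have hFB : ∀ f, F (WB f) = bobAct (F f) := fun f => by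
    funext i r j
    simp only [F, hWB, Equiv.apply_symm_apply]
  let ψ : l2 ℕ := lp.single 2 (e.symm 0) 1
  have hψ : ∀ n, ψ n = if e n = 0 then 1 else 0 := fun n => by
    simp [ψ, lp.single_apply, Pi.single_apply, Equiv.eq_symm_apply]
  let z : l2 (Fin 2 × ℕ × Fin 2) := lp.single 2 (0, e.symm 0, 0) 1
  have hz : ∀ i n j, z (i, n, j) = if i = 0 ∧ j = 0 then ψ n else 0 := fun i n j => by
    simp only [z, hψ, lp.single_apply, Pi.single_apply, Prod.mk.injEq, Equiv.eq_symm_apply]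
    split_ifs <;> first | rfl | (exfalso; tauto)
  refine ⟨ψ, (aliceGate.pullback eA).unitary, (bobGate.pullback eB).unitary, WA, WB, ?_, ?_, ?_,
    ?_, z, WA (WB z), hz, ?_, rfl⟩
  · simp [ψ]
  · intro f g j h i n
    rw [hWA, Gate.unitary_apply, Gate.act_pullback, aliceAct]
    congr 1
    funext x
    exact ((h _ _).trans (by simp [F])).symm
  · intro f g i h n j
    rw [hWB, Gate.unitary_apply, Gate.act_pullback, bobAct]
    congr 1
    funext x
    exact ((h _ _).trans (by simp [F])).symm
  · intro f
    ext ⟨i, n, j⟩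
    rw [hWA, hWB, hFA, hFB, aliceAct_bobAct]
  · intro i n j
    rw [hWA, hFB, aliceAct_bobAct_apply_single, hψ]
    · simp
    · intro i r j
      simp [F, hz, hψ, ← hc0]
end

section
/- There exist a unit vector ψ ∈ ℓ²(ℕ) and families U, V : Fin 2 → Fin 2 → (ℓ²(ℕ) →L[ℂ] ℓ²(ℕ)) of bounded operators such that U and V are unitary operator matrices, the families U and V *-commute, and U, V satisfy the perfect embezzlement relations for ψ. (Equivalently, a perfect embezzlement protocol for a Bell state exists in the commuting operator framework.) -/
/-- A family `U : Fin d → Fin d → (H →L[ℂ] H)` is a unitary operator matrix. -/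
def IsUnitaryOpMatrix {H : Type*} [NormedAddCommGroup H] [InnerProductSpace ℂ H]
    [CompleteSpace H] {d : ℕ} (U : Fin d → Fin d → (H →L[ℂ] H)) : Prop :=
  (∀ i j, ∑ k, (ContinuousLinearMap.adjoint (U k i)) ∘L (U k j)
      = if i = j then (1 : H →L[ℂ] H) else 0) ∧
  (∀ i j, ∑ k, (U i k) ∘L (ContinuousLinearMap.adjoint (U j k))
      = if i = j then (1 : H →L[ℂ] H) else 0)

/-- Two families of bounded operators *-commute entrywise. -/
def StarCommuteFamilies {H : Type*} [NormedAddCommGroup H] [InnerProductSpace ℂ H]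
    [CompleteSpace H] {d : ℕ} (U V : Fin d → Fin d → (H →L[ℂ] H)) : Prop :=
  ∀ i j k l, (U i j) ∘L (V k l) = (V k l) ∘L (U i j) ∧
    (ContinuousLinearMap.adjoint (U i j)) ∘L (V k l)
      = (V k l) ∘L (ContinuousLinearMap.adjoint (U i j))


/-- A pair of isometries with complementary ranges, i.e. a representation of the Cuntz algebra
`𝒪₂`. -/
structure IsCuntzPair {A : Type*} [Ring A] [StarRing A] (s : Fin 2 → A) : Prop where
  star_mul : ∀ i j, star (s i) * s j = if i = j then 1 else 0
  sum_mul_star : ∑ i, s i * star (s i) = 1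

open Filter Topology ContinuousLinearMap

section Shift

lemma orthonormal_single_comp {e : ℕ → ℕ} (he : Function.Injective e) :
    Orthonormal ℂ fun n => (lp.single 2 (e n) (1 : ℂ) : l2 ℕ) := by
  rw [orthonormal_iff_ite]
  intro i j
  rw [lp.inner_single_left]
  simp [Pi.single_apply, he.eq_iff]

/-- The isometry of `ℓ²(ℕ)` sending the `n`-th basis vector to the `e n`-th one. -/
noncomputable def basisMap (e : ℕ → ℕ) (he : Function.Injective e) : l2 ℕ →L[ℂ] l2 ℕ :=
  (orthonormal_single_comp he).orthogonalFamily.linearIsometry.toContinuousLinearMap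

lemma basisMap_single (e : ℕ → ℕ) (he : Function.Injective e) (n : ℕ) (c : ℂ) :
    basisMap e he (lp.single 2 n c) = lp.single 2 (e n) c := by
  rw [basisMap, LinearIsometry.coe_toContinuousLinearMap,
    OrthogonalFamily.linearIsometry_apply_single]
  simp [← lp.single_smul]

lemma adjoint_basisMap_apply (e : ℕ → ℕ) (he : Function.Injective e) (f : l2 ℕ) (n : ℕ) :
    adjoint (basisMap e he) f n = f (e n) := by
  have h := adjoint_inner_right (basisMap e he) (lp.single 2 n (1 : ℂ)) f
  rw [basisMap_single, lp.inner_single_left, lp.inner_single_left] at h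
  simpa using h

lemma adjoint_basisMap_single (e : ℕ → ℕ) (he : Function.Injective e) (n : ℕ) (c : ℂ) :
    adjoint (basisMap e he) (lp.single 2 (e n) c) = lp.single 2 n c := by
  ext m
  rw [adjoint_basisMap_apply]
  simp [lp.single_apply, Pi.single_apply, he.eq_iff]

lemma adjoint_basisMap_single_of_notMem (e : ℕ → ℕ) (he : Function.Injective e) {n : ℕ}
    (hn : ∀ m, e m ≠ n) (c : ℂ) : adjoint (basisMap e he) (lp.single 2 n c) = 0 := by
  ext m
  rw [adjoint_basisMap_apply]
  simp [lp.single_apply, hn]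

lemma l2_ext {F G : l2 ℕ →L[ℂ] l2 ℕ}
    (h : ∀ n c, F (lp.single 2 n c) = G (lp.single 2 n c)) : F = G := by
  refine lp.ext_continuousLinearMap (by norm_num) fun n => ?_
  ext
  simpa using congrArg (fun v : l2 ℕ => v _) (h n 1)

theorem exists_isCuntzPair : ∃ s : Fin 2 → (l2 ℕ →L[ℂ] l2 ℕ), IsCuntzPair s := by
  have inj (i : Fin 2) : Function.Injective fun n : ℕ => 2 * n + (i : ℕ) := fun a b h => by
    simp only at h; omega
  have ne {i j : Fin 2} (h : i ≠ j) (m n : ℕ) : 2 * m + (i : ℕ) ≠ 2 * n + (j : ℕ) := by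
    intro h'; apply h; ext; omega
  have hs (i j : Fin 2) (n : ℕ) (c : ℂ) :
      adjoint (basisMap _ (inj i)) (lp.single 2 (2 * n + (j : ℕ)) c) =
        if i = j then (lp.single 2 n c : l2 ℕ) else 0 := by
    split_ifs with h
    · subst h
      exact adjoint_basisMap_single _ (inj i) n c
    · exact adjoint_basisMap_single_of_notMem _ (inj i) (fun m => ne h m n) c
  refine ⟨fun i => basisMap _ (inj i), fun i j => l2_ext fun n c => ?_, l2_ext fun n c => ?_⟩
  · rw [star_eq_adjoint, mul_def, comp_apply, basisMap_single, hs]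
    split_ifs <;> rfl
  · obtain ⟨j, m, rfl⟩ : ∃ (j : Fin 2) (m : ℕ), n = 2 * m + (j : ℕ) :=
      ⟨⟨n % 2, by omega⟩, n / 2, by simp; omega⟩
    simp only [sum_apply, mul_def, comp_apply, star_eq_adjoint]
    rw [Finset.sum_eq_single j (fun i _ h => by rw [hs, if_neg h, map_zero]) (by simp), hs,
      if_pos rfl, basisMap_single]
    rfl

end Shift

namespace IsCuntzPair

variable {A : Type*} [CStarAlgebra A] {s : Fin 2 → A}

lemma norm_le_one (hs : IsCuntzPair s) (i : Fin 2) : ‖s i‖ ≤ 1 := by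
  have h := CStarRing.norm_star_mul_self (x := s i)
  rw [hs.star_mul, if_pos rfl] at h
  have h1 : ‖(1 : A)‖ ≤ 1 := by
    have h2 := CStarRing.norm_star_mul_self (x := (1 : A))
    rw [star_one, one_mul] at h2
    nlinarith [norm_nonneg (1 : A)]
  nlinarith [norm_nonneg (s i)]

end IsCuntzPair

/-- The averaging map `x ↦ ½ ∑ i, sᵢ* x sᵢ`. -/
noncomputable def cuntzAverage {A : Type*} [CStarAlgebra A] (s : Fin 2 → A) : A →ₗ[ℂ] A where
  toFun x := (1 / 2 : ℂ) • ∑ i, star (s i) * x * s i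
  map_add' x y := by simp [mul_add, add_mul]; module
  map_smul' c x := by simp; module

section State

variable {A : Type*} [CStarAlgebra A] {s : Fin 2 → A}

lemma norm_cuntzAverage_le (hs : IsCuntzPair s) (x : A) : ‖cuntzAverage s x‖ ≤ ‖x‖ := by
  have h (i : Fin 2) : ‖star (s i) * x * s i‖ ≤ ‖x‖ := by
    calc ‖star (s i) * x * s i‖ ≤ ‖star (s i)‖ * ‖x‖ * ‖s i‖ :=
          (norm_mul_le _ _).trans (by gcongr; exact norm_mul_le _ _)
      _ ≤ 1 * ‖x‖ * 1 := by
          rw [norm_star]; gcongr <;> exact hs.norm_le_one i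
      _ = ‖x‖ := by ring
  calc ‖cuntzAverage s x‖ ≤ ‖(1 / 2 : ℂ)‖ * ∑ i : Fin 2, ‖x‖ := by
        rw [cuntzAverage, LinearMap.coe_mk, AddHom.coe_mk, norm_smul]
        gcongr
        exact norm_sum_le_of_le _ fun i _ => h i
    _ = ‖x‖ := by simp

lemma norm_iterate_cuntzAverage_le (hs : IsCuntzPair s) (n : ℕ) (x : A) :
    ‖((cuntzAverage s) ^ n) x‖ ≤ ‖x‖ := by
  induction n with
  | zero => simp
  | succ n ih =>
    rw [pow_succ', Module.End.mul_apply]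
    exact (norm_cuntzAverage_le hs _).trans ih

lemma cuntzAverage_one (hs : IsCuntzPair s) : cuntzAverage s 1 = 1 := by
  simp only [cuntzAverage, LinearMap.coe_mk, AddHom.coe_mk, mul_one, hs.star_mul, if_pos,
    Finset.sum_const, Finset.card_univ, Fintype.card_fin, two_nsmul]
  module

lemma iterate_cuntzAverage_one (hs : IsCuntzPair s) (n : ℕ) :
    ((cuntzAverage s) ^ n) 1 = 1 := by
  induction n with
  | zero => simp
  | succ n ih => rw [pow_succ', Module.End.mul_apply, ih, cuntzAverage_one hs]

lemma cuntzAverage_conj (hs : IsCuntzPair s) (i j : Fin 2) (x : A) :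
    cuntzAverage s (s i * x * star (s j)) = if i = j then (1 / 2 : ℂ) • x else 0 := by
  have h (k : Fin 2) : star (s k) * (s i * x * star (s j)) * s k =
      (star (s k) * s i) * x * (star (s j) * s k) := by simp only [mul_assoc]
  simp only [cuntzAverage, LinearMap.coe_mk, AddHom.coe_mk, h, hs.star_mul]
  split_ifs with hij
  · subst hij
    simp
  · rw [Finset.sum_eq_zero, smul_zero]
    intro k _
    by_cases hk : k = i
    · subst hk; simp [Ne.symm hij]
    · simp [hk]

lemma cuntzAverage_nonneg [PartialOrder A] [StarOrderedRing A] {x : A} (hx : 0 ≤ x) :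
    0 ≤ cuntzAverage s x := by
  have h (i : Fin 2) : 0 ≤ star (s i) * x * s i := star_left_conjugate_nonneg hx _
  have h2 : cuntzAverage s x = (1 / 2 : ℝ) • ∑ i, star (s i) * x * s i := by
    simp only [cuntzAverage, LinearMap.coe_mk, AddHom.coe_mk]
    rw [← Complex.coe_smul]; norm_num
  rw [h2]
  exact smul_nonneg (by norm_num) (Finset.sum_nonneg fun i _ => h i)

lemma iterate_cuntzAverage_nonneg [PartialOrder A] [StarOrderedRing A] (n : ℕ) {x : A}
    (hx : 0 ≤ x) : 0 ≤ ((cuntzAverage s) ^ n) x := by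
  induction n with
  | zero => simpa
  | succ n ih => rw [pow_succ', Module.End.mul_apply]; exact cuntzAverage_nonneg ih

open scoped ComplexOrder

/-- The KMS state of a Cuntz pair, obtained by averaging an arbitrary contractive state. -/
theorem exists_kms_state [PartialOrder A] [StarOrderedRing A] (hs : IsCuntzPair s)
    (f₀ : A →ₚ[ℂ] ℂ) (hone : f₀ 1 = 1) (hbound : ∀ x, ‖f₀ x‖ ≤ ‖x‖) :
    ∃ f : A →ₚ[ℂ] ℂ, f 1 = 1 ∧
      ∀ i j x, f (s i * x * star (s j)) = if i = j then (1 / 2 : ℂ) * f x else 0 := by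
  let c (N : ℕ) : A →ₗ[ℂ] ℂ :=
    ((N + 1 : ℂ)⁻¹) • ∑ n ∈ Finset.range (N + 1), f₀.toLinearMap ∘ₗ (cuntzAverage s) ^ n
  have c_apply (N : ℕ) (x : A) : c N x =
      (N + 1 : ℂ)⁻¹ * ∑ n ∈ Finset.range (N + 1), f₀ (((cuntzAverage s) ^ n) x) := by
    simp [c]
  have norm_cast_succ (N : ℕ) : ‖(N + 1 : ℂ)‖ = N + 1 := by
    exact_mod_cast Complex.norm_natCast (N + 1)
  have term_le (n : ℕ) (x : A) : ‖f₀ (((cuntzAverage s) ^ n) x)‖ ≤ ‖x‖ :=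
    (hbound _).trans (norm_iterate_cuntzAverage_le hs n x)
  have c_le (N : ℕ) (x : A) : c N x ∈ Metric.closedBall (0 : ℂ) ‖x‖ := by
    rw [mem_closedBall_zero_iff, c_apply, norm_mul, norm_inv, norm_cast_succ,
      inv_mul_le_iff₀ (by positivity)]
    refine (norm_sum_le_of_le _ fun n _ => term_le n x).trans ?_
    simp
  let l : Ultrafilter ℕ := hyperfilter ℕ
  have hl : (l : Filter ℕ) ≤ atTop := Nat.hyperfilter_le_atTop
  have lim (x : A) : ∃ y, Tendsto (fun N => c N x) l (𝓝 y) := by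
    obtain ⟨y, -, hy⟩ := (isCompact_closedBall (0 : ℂ) ‖x‖).ultrafilter_le_nhds'
      (l.map fun N => c N x) (Ultrafilter.mem_map.mpr (univ_mem' fun N => c_le N x))
    exact ⟨y, hy⟩
  choose φ hφ using lim
  have φ_unique {x : A} {y : ℂ} (h : Tendsto (fun N => c N x) l (𝓝 y)) : φ x = y :=
    tendsto_nhds_unique (hφ x) h
  let φL : A →ₗ[ℂ] ℂ :=
    { toFun := φ
      map_add' := fun x y => φ_unique (by simpa using (hφ x).add (hφ y))
      map_smul' := fun a x => φ_unique (by simpa using (hφ x).const_mul a) }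
  have φ_nonneg (x : A) (hx : 0 ≤ x) : 0 ≤ φL x := by
    refine ge_of_tendsto (hφ x) (Eventually.of_forall fun N => ?_)
    rw [c_apply]
    refine mul_nonneg ?_ (Finset.sum_nonneg fun n _ =>
      map_nonneg f₀ (iterate_cuntzAverage_nonneg n hx))
    rw [inv_nonneg]
    exact_mod_cast (N + 1).cast_nonneg
  have φ_average (x : A) : φ (cuntzAverage s x) = φ x := by
    refine (sub_eq_zero.mp (tendsto_nhds_unique ((hφ _).sub (hφ x)) ?_))
    refine squeeze_zero_norm (a := fun N : ℕ => (2 * ‖x‖) * (1 / ((N : ℝ) + 1))) (fun N => ?_) ?_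
    · rw [c_apply, c_apply, ← mul_sub, norm_mul, norm_inv, norm_cast_succ, mul_comm, one_div]
      gcongr
      have : ∀ n, ((cuntzAverage s) ^ n) (cuntzAverage s x) = ((cuntzAverage s) ^ (n + 1)) x :=
        fun n => by rw [pow_succ, Module.End.mul_apply]
      simp only [this]
      rw [← Finset.sum_sub_distrib,
        Finset.sum_range_sub (fun n => f₀ (((cuntzAverage s) ^ n) x)), two_mul]
      exact (norm_sub_le _ _).trans (add_le_add (term_le _ x) (term_le _ x))
    · have := (tendsto_one_div_add_atTop_nhds_zero_nat (𝕜 := ℝ)).const_mul (2 * ‖x‖)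
      rw [mul_zero] at this
      exact this.mono_left hl
  refine ⟨PositiveLinearMap.mk₀ φL φ_nonneg, φ_unique ?_, fun i j x => ?_⟩
  · have (N : ℕ) : c N 1 = 1 := by
      have h : (N + 1 : ℂ) ≠ 0 := by exact_mod_cast N.succ_ne_zero
      simp [c_apply, iterate_cuntzAverage_one hs, hone, h]
    simp [this]
  · change φL (s i * x * star (s j)) = if i = j then (1 / 2 : ℂ) * φL x else 0
    have : φL (s i * x * star (s j)) = φL (cuntzAverage s (s i * x * star (s j))) :=
      (φ_average _).symm
    rw [this, cuntzAverage_conj hs]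
    split_ifs <;> simp

end State

section GNS

open scoped ComplexOrder InnerProductSpace
open UniformSpace

variable {A : Type} [CStarAlgebra A] [PartialOrder A] [StarOrderedRing A]

/-- Right multiplication by `c` on the GNS space of a functional that it scales by a factor `r`. -/
noncomputable def gnsRightMul (f : A →ₚ[ℂ] ℂ) (c : A) (r : ℝ)
    (h : ∀ x, f (star c * x * c) = r * f x) : f.GNS →L[ℂ] f.GNS :=
  ContinuousLinearMap.completion <|
    ((f.toPreGNS.toLinearMap ∘ₗ (LinearMap.mulRight ℂ c) ∘ₗ f.ofPreGNS.toLinearMap :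
      f.PreGNS →ₗ[ℂ] f.PreGNS)).mkContinuous (√r) fun x => by
    rw [f.preGNS_norm_def, f.preGNS_norm_def]
    have : star (f.ofPreGNS x * c) * (f.ofPreGNS x * c) =
        star c * (star (f.ofPreGNS x) * f.ofPreGNS x) * c := by simp [mul_assoc]
    simp only [LinearMap.comp_apply, LinearEquiv.coe_coe, LinearMap.mulRight_apply,
      PositiveLinearMap.ofPreGNS_toPreGNS, this, h, Complex.re_ofReal_mul]
    rw [Real.sqrt_mul' _ (Complex.nonneg_iff.mp (f.map_nonneg (star_mul_self_nonneg _))).1]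

lemma gnsRightMul_coe (f : A →ₚ[ℂ] ℂ) (c : A) (r : ℝ)
    (h : ∀ x, f (star c * x * c) = r * f x) (x : f.PreGNS) :
    gnsRightMul f c r h (x : f.GNS) = (f.toPreGNS (f.ofPreGNS x * c) : f.PreGNS) := by
  simp [gnsRightMul]

theorem exists_gns_bimodule (f : A →ₚ[ℂ] ℂ) :
    ∃ (H : Type) (_ : NormedAddCommGroup H) (_ : InnerProductSpace ℂ H) (_ : CompleteSpace H)
      (ι : A →ₗ[ℂ] H) (π : A →⋆ₐ[ℂ] (H →L[ℂ] H)), DenseRange ι ∧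
      (∀ a b, ⟪ι a, ι b⟫_ℂ = f (star a * b)) ∧ (∀ a b, π a (ι b) = ι (a * b)) ∧
      ∀ (c : A) (r : ℝ), (∀ x, f (star c * x * c) = r * f x) →
        ∃ R : H →L[ℂ] H, ∀ a, R (ι a) = ι (a * c) := by
  refine ⟨f.GNS, inferInstance, inferInstance, inferInstance,
    (Completion.toComplL (𝕜 := ℂ) (E := f.PreGNS)).toLinearMap ∘ₗ f.toPreGNS.toLinearMap,
    f.gnsStarAlgHom, ?_, fun a b => ?_, fun a b => ?_, fun c r h => ⟨gnsRightMul f c r h, ?_⟩⟩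
  · exact Completion.denseRange_coe.comp f.toPreGNS.surjective.denseRange
      (Completion.continuous_coe _)
  · exact Completion.inner_coe _ _
  · exact f.gnsNonUnitalStarAlgHom_apply_coe
  · exact fun a => gnsRightMul_coe f c r h _

end GNS

section CommutingPairs

open scoped ComplexOrder InnerProductSpace

theorem exists_commuting_cuntz_pairs_of_kms_state {A : Type} [CStarAlgebra A] [PartialOrder A]
    [StarOrderedRing A] {s : Fin 2 → A} (hs : IsCuntzPair s) (f : A →ₚ[ℂ] ℂ) (hone : f 1 = 1)
    (hf : ∀ i j x, f (s i * x * star (s j)) = if i = j then (1 / 2 : ℂ) * f x else 0) :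
    ∃ (H : Type) (_ : NormedAddCommGroup H) (_ : InnerProductSpace ℂ H) (_ : CompleteSpace H)
      (ψ : H) (S T : Fin 2 → (H →L[ℂ] H)), ‖ψ‖ = 1 ∧ IsCuntzPair S ∧ IsCuntzPair T ∧
      (∀ i j, S i * T j = T j * S i) ∧ ∑ i, S i (T i ψ) = (√2 : ℂ) • ψ := by
  obtain ⟨H, _, _, _, ι, π, hι, hinner, hπ, hR⟩ := exists_gns_bimodule f
  have hr (j : Fin 2) (x : A) : f (star (star (s j)) * x * star (s j)) = (1 / 2 : ℝ) * f x := by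
    rw [star_star, hf, if_pos rfl]; norm_num
  choose R R_apply using fun j => hR (star (s j)) (1 / 2) (hr j)
  have sq_two : (√2 : ℂ) * √2 = 2 := by
    rw [← Complex.ofReal_mul, Real.mul_self_sqrt (by norm_num)]; norm_num
  have h2 : (√2 : ℂ) ≠ 0 := by intro h; simp [h] at sq_two
  let T (j : Fin 2) : H →L[ℂ] H := (√2 : ℂ) • R j
  have T_apply (j : Fin 2) (a : A) : T j (ι a) = (√2 : ℂ) • ι (a * star (s j)) := by
    rw [← R_apply]; rfl
  have T_star_mul (i j : Fin 2) : star (T i) * T j = if i = j then 1 else 0 := by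
    refine ContinuousLinearMap.ext fun y => ext_inner_left ℂ fun x => ?_
    rw [star_eq_adjoint, mul_def, comp_apply, adjoint_inner_right]
    refine hι.induction_on₂ (isClosed_eq (by fun_prop) (by fun_prop)) (fun a b => ?_) x y
    have h : star (a * star (s i)) * (b * star (s j)) =
        s i * (star a * b) * star (s j) := by simp [mul_assoc]
    rw [T_apply, T_apply, inner_smul_left, inner_smul_right, Complex.conj_ofReal, ← mul_assoc,
      sq_two, hinner, h, hf]
    split_ifs
    · rw [one_apply_eq_self, hinner]
      ring
    · simp
  have hS : IsCuntzPair fun i => π (s i) := by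
    refine ⟨fun i j => ?_, ?_⟩
    · rw [← map_star, ← map_mul, hs.star_mul]
      split_ifs <;> simp
    · simp_rw [← map_star, ← map_mul]
      rw [← map_sum, hs.sum_mul_star, map_one]
  have hT : IsCuntzPair T := by
    refine ⟨T_star_mul, ContinuousLinearMap.ext fun y => ?_⟩
    have key (k : Fin 2) : (∑ i, T i * star (T i)) * T k = T k := by
      rw [Finset.sum_mul, Finset.sum_eq_single k]
      · rw [mul_assoc, T_star_mul, if_pos rfl, mul_one]
      · intro i _ hi
        rw [mul_assoc, T_star_mul, if_neg hi, mul_zero]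
      · simp
    refine hι.induction_on y (isClosed_eq (by fun_prop) (by fun_prop)) fun a => ?_
    have ha : ι a = ∑ k, T k ((√2 : ℂ)⁻¹ • ι (a * s k)) := by
      simp only [map_smul, T_apply, smul_smul, inv_mul_cancel₀ h2, one_smul]
      simp_rw [← map_sum, mul_assoc, ← Finset.mul_sum]
      rw [hs.sum_mul_star, mul_one]
    rw [ha, map_sum, map_sum]
    refine Finset.sum_congr rfl fun k _ => ?_
    rw [← comp_apply, ← mul_def, key]
    rfl
  refine ⟨H, inferInstance, inferInstance, inferInstance, ι 1, fun i => π (s i), T, ?_, hS, hT,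
    fun i j => ?_, ?_⟩
  · rw [← sq_eq_sq₀ (norm_nonneg _) zero_le_one, @norm_sq_eq_re_inner ℂ, hinner]
    simp [hone]
  · refine ContinuousLinearMap.ext fun y => ?_
    rw [mul_def, mul_def, comp_apply, comp_apply]
    refine hι.induction_on y (isClosed_eq (by fun_prop) (by fun_prop)) fun a => ?_
    rw [T_apply, map_smul, hπ, hπ, T_apply, mul_assoc]
  · simp only [T_apply, map_smul, hπ, one_mul]
    rw [← Finset.smul_sum, ← map_sum, hs.sum_mul_star]

theorem exists_commuting_cuntz_pairs :
    ∃ (H : Type) (_ : NormedAddCommGroup H) (_ : InnerProductSpace ℂ H) (_ : CompleteSpace H)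
      (ψ : H) (S T : Fin 2 → (H →L[ℂ] H)), ‖ψ‖ = 1 ∧ IsCuntzPair S ∧ IsCuntzPair T ∧
      (∀ i j, S i * T j = T j * S i) ∧ ∑ i, S i (T i ψ) = (√2 : ℂ) • ψ := by
  obtain ⟨s, hs⟩ := exists_isCuntzPair
  let e : l2 ℕ := lp.single 2 0 (1 : ℂ)
  have he : ‖e‖ = 1 := by
    simp [e, lp.norm_single]
  let f₀ : (l2 ℕ →L[ℂ] l2 ℕ) →ₚ[ℂ] ℂ := PositiveLinearMap.mk₀
    { toFun := fun x => ⟪e, x e⟫_ℂ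
      map_add' := fun x y => by simp
      map_smul' := fun c x => by simp }
    (fun x hx => by
      simpa using ((ContinuousLinearMap.nonneg_iff_isPositive x).mp hx).inner_nonneg_right e)
  have f₀_apply (x : l2 ℕ →L[ℂ] l2 ℕ) : f₀ x = ⟪e, x e⟫_ℂ := rfl
  obtain ⟨f, hone, hf⟩ := exists_kms_state hs f₀
    (by rw [f₀_apply, one_apply_eq_self, inner_self_eq_norm_sq_to_K, he]; simp)
    (fun x => by
      rw [f₀_apply]
      refine (norm_inner_le_norm _ _).trans ?_
      simpa [he] using x.le_opNorm e)
  exact exists_commuting_cuntz_pairs_of_kms_state hs f hone hf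

end CommutingPairs

section Separable

variable {H : Type*} [NormedAddCommGroup H] [InnerProductSpace ℂ H]

lemma Orthonormal.countable [TopologicalSpace.SeparableSpace H] {ι : Type*} {v : ι → H}
    (hv : Orthonormal ℂ v) : Countable ι := by
  refine Pairwise.countable_of_isOpen_disjoint (s := fun i => Metric.ball (v i) (1 / 2))
    (fun i j hij => Metric.ball_disjoint_ball ?_) (fun i => Metric.isOpen_ball)
    (fun i => ⟨v i, Metric.mem_ball_self (by norm_num)⟩)
  have h : ‖v i - v j‖ ^ 2 = 2 := by
    rw [@norm_sub_sq ℂ, hv.1 i, hv.1 j, hv.2 hij]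
    norm_num
  rw [dist_eq_norm]
  nlinarith [norm_nonneg (v i - v j)]

theorem exists_hilbertBasis_nat [CompleteSpace H] [TopologicalSpace.SeparableSpace H]
    (hH : ¬ FiniteDimensional ℂ H) : Nonempty (HilbertBasis ℕ ℂ H) := by
  obtain ⟨w, b, -⟩ := exists_hilbertBasis ℂ H
  have : Countable w := b.orthonormal.countable
  have : Infinite w := by
    by_contra hw
    rw [not_infinite_iff_finite] at hw
    have hfin : FiniteDimensional ℂ (Submodule.span ℂ (Set.range b)) :=
      FiniteDimensional.span_of_finite ℂ (Set.finite_range b)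
    have h := b.dense_span
    rw [(Submodule.closed_of_finiteDimensional _).submodule_topologicalClosure_eq] at h
    rw [h] at hfin
    exact hH (Submodule.topEquiv.finiteDimensional)
  obtain ⟨e⟩ : Nonempty (ℕ ≃ w) := nonempty_equiv_of_countable
  refine ⟨HilbertBasis.mk (b.orthonormal.comp e e.injective) ?_⟩
  rw [e.surjective.range_comp, b.dense_span]

theorem exists_isometry_invariant_range [CompleteSpace H] {ι : Type*} [Countable ι]
    (L : ι → (H →L[ℂ] H)) (ψ : H)
    (hinf : ∀ K : Submodule ℂ H, (∀ i, ∀ x ∈ K, L i x ∈ K) → ψ ∈ K → ¬ FiniteDimensional ℂ K) :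
    ∃ J : l2 ℕ →ₗᵢ[ℂ] H, (∃ φ, J φ = ψ) ∧ ∀ i x, ∃ y, J y = L i (J x) := by
  let W : List ι → H := fun l => l.foldr (fun i v => L i v) ψ
  let K : Submodule ℂ H := (Submodule.span ℂ (Set.range W)).topologicalClosure
  have hψ : ψ ∈ K := Submodule.le_topologicalClosure _ (Submodule.subset_span ⟨[], rfl⟩)
  have hL (i : ι) (x : H) (hx : x ∈ K) : L i x ∈ K := by
    have hle : Submodule.span ℂ (Set.range W) ≤
        (Submodule.span ℂ (Set.range W)).comap (L i).toLinearMap := by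
      rw [Submodule.span_le]
      rintro _ ⟨l, rfl⟩
      exact Submodule.subset_span ⟨i :: l, rfl⟩
    exact map_mem_closure (L i).continuous hx fun y hy => hle hy
  have : CompleteSpace K := (Submodule.isClosed_topologicalClosure _).completeSpace_coe
  have : TopologicalSpace.SeparableSpace K :=
    ((Set.countable_range W).isSeparable.span (R := ℂ)).closure.separableSpace
  obtain ⟨b⟩ := exists_hilbertBasis_nat (hinf K hL hψ)
  refine ⟨K.subtypeₗᵢ.comp b.repr.symm.toLinearIsometry, ⟨b.repr ⟨ψ, hψ⟩, by simp⟩, fun i x => ?_⟩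
  exact ⟨b.repr ⟨L i (b.repr.symm x), hL i _ (b.repr.symm x).2⟩, by simp⟩

end Separable

section Compression

variable {H : Type*} [NormedAddCommGroup H] [InnerProductSpace ℂ H] [CompleteSpace H]

lemma IsCuntzPair.not_finiteDimensional {S : Fin 2 → (H →L[ℂ] H)} (hS : IsCuntzPair S)
    (K : Submodule ℂ H) (hK : ∀ i, ∀ x ∈ K, S i x ∈ K) {ψ : H} (hψ : ψ ∈ K) (hψ0 : ψ ≠ 0) :
    ¬ FiniteDimensional ℂ K := by
  intro hfin
  have star_apply (i j : Fin 2) (x : H) : star (S i) (S j x) = if i = j then x else 0 := by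
    rw [← comp_apply, ← mul_def, hS.star_mul]
    split_ifs <;> rfl
  let F : K →ₗ[ℂ] K := (S 0).toLinearMap.restrict (hK 0)
  have hF : Function.Injective F := fun x y hxy => by
    have h : S 0 (x : H) = S 0 (y : H) := congrArg Subtype.val hxy
    have h' := congrArg (star (S 0) : H →L[ℂ] H) h
    rw [star_apply, star_apply, if_pos rfl, if_pos rfl] at h'
    exact Subtype.ext h'
  obtain ⟨y, hy⟩ := (LinearMap.injective_iff_surjective.mp hF) ⟨S 1 ψ, hK 1 ψ hψ⟩
  have h : S 0 (y : H) = S 1 ψ := congrArg Subtype.val hy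
  have h' := congrArg (star (S 1) : H →L[ℂ] H) h
  rw [star_apply, star_apply, if_pos rfl, if_neg (by decide)] at h'
  exact hψ0 h'.symm

theorem exists_commuting_cuntz_pairs_l2 :
    ∃ (ψ : l2 ℕ) (S T : Fin 2 → (l2 ℕ →L[ℂ] l2 ℕ)), ‖ψ‖ = 1 ∧ IsCuntzPair S ∧ IsCuntzPair T ∧
      (∀ i j, S i * T j = T j * S i) ∧ ∑ i, S i (T i ψ) = (√2 : ℂ) • ψ := by
  obtain ⟨H, _, _, _, ψ, S, T, hψ, hS, hT, hST, hfix⟩ := exists_commuting_cuntz_pairs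
  let L : (Fin 2 ⊕ Fin 2) ⊕ (Fin 2 ⊕ Fin 2) → (H →L[ℂ] H) :=
    Sum.elim (Sum.elim S (star S)) (Sum.elim T (star T))
  obtain ⟨J, ⟨φ, hφ⟩, hJ⟩ := exists_isometry_invariant_range L ψ (fun K hK hψK =>
      hS.not_finiteDimensional K (fun i => hK (.inl (.inl i))) hψK
        (norm_ne_zero_iff.mp (by rw [hψ]; exact one_ne_zero)))
  let C (X : H →L[ℂ] H) : l2 ℕ →L[ℂ] l2 ℕ :=
    adjoint J.toContinuousLinearMap ∘L X ∘L J.toContinuousLinearMap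
  have adjoint_apply (x : l2 ℕ) : adjoint J.toContinuousLinearMap (J x) = x := by
    refine ext_inner_left ℂ fun y => ?_
    rw [adjoint_inner_right]
    exact J.inner_map_map y x
  have C_star (X : H →L[ℂ] H) : star (C X) = C (star X) := by
    simp [C, star_eq_adjoint, adjoint_comp, comp_assoc]
  have C_apply {X : H →L[ℂ] H} (hX : ∀ x, ∃ y, J y = X (J x)) (x : l2 ℕ) :
      J (C X x) = X (J x) := by
    obtain ⟨y, hy⟩ := hX x
    change J (adjoint J.toContinuousLinearMap (X (J x))) = X (J x)
    rw [← hy, adjoint_apply]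
  have C_S (i) := C_apply (hJ (.inl (.inl i)))
  have C_S' (i) := C_apply (hJ (.inl (.inr i)))
  have C_T (i) := C_apply (hJ (.inr (.inl i)))
  have C_T' (i) := C_apply (hJ (.inr (.inr i)))
  simp only [L, Sum.elim_inl, Sum.elim_inr, Pi.star_apply] at C_S C_S' C_T C_T'
  have pair {X : Fin 2 → (H →L[ℂ] H)} (hX : IsCuntzPair X) (h : ∀ i x, J (C (X i) x) = X i (J x))
      (h' : ∀ i x, J (C (star (X i)) x) = star (X i) (J x)) : IsCuntzPair fun i => C (X i) := by
    refine ⟨fun i j => ContinuousLinearMap.ext fun x => J.injective ?_,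
      ContinuousLinearMap.ext fun x => J.injective ?_⟩
    · rw [C_star, mul_def, comp_apply, h', h, ← comp_apply, ← mul_def, hX.star_mul]
      split_ifs <;> simp
    · simp only [C_star, mul_def, sum_apply, comp_apply, map_sum, h, h']
      simp only [← comp_apply, ← mul_def, ← sum_apply, hX.sum_mul_star]
      rfl
  refine ⟨φ, fun i => C (S i), fun i => C (T i), ?_, pair hS C_S C_S', pair hT C_T C_T',
    fun i j => ContinuousLinearMap.ext fun x => J.injective ?_, J.injective ?_⟩
  · rw [← J.norm_map, hφ, hψ]
  · change J (C (S i) (C (T j) x)) = J (C (T j) (C (S i) x))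
    rw [C_S, C_T, C_T, C_S]
    exact congrArg (fun X : H →L[ℂ] H => X (J x)) (hST i j)
  · simp only [map_sum, C_S, C_T, hφ, hfix, map_smul]

end Compression

section Embezzlement

/-- The unitary operator matrix built from a Cuntz pair which moves one qubit of entanglement out
of the range of `s 0`. -/
def cuntzMatrix {A : Type*} [Ring A] [StarRing A] (s : Fin 2 → A) : Fin 2 → Fin 2 → A :=
  ![![s 0 * star (s 0) * star (s 0) + s 1 * star (s 1), 0],
    ![s 0 * star (s 1) * star (s 0), s 1]]

variable {A : Type*} [Ring A] [StarRing A]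

lemma IsCuntzPair.star_mul_assoc {s : Fin 2 → A} (hs : IsCuntzPair s) (i j : Fin 2) (x : A) :
    star (s i) * (s j * x) = if i = j then x else 0 := by
  rw [← mul_assoc, hs.star_mul]
  split_ifs <;> simp

lemma IsCuntzPair.star_commute {s : Fin 2 → A} (hs : IsCuntzPair s) {t : A}
    (h : ∀ i, Commute (s i) t) (i : Fin 2) : Commute (star (s i)) t := by
  calc star (s i) * t = star (s i) * t * ∑ j, s j * star (s j) := by rw [hs.sum_mul_star, mul_one]
    _ = ∑ j, star (s i) * (s j * (t * star (s j))) := by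
        rw [Finset.mul_sum]
        refine Finset.sum_congr rfl fun j _ => ?_
        rw [mul_assoc, ← mul_assoc t, ← (h j).eq, mul_assoc]
    _ = t * star (s i) := by
        simp only [hs.star_mul_assoc]
        simp

lemma cuntzMatrix_commute {s : Fin 2 → A} {t : A} (h : ∀ i, Commute (s i) t)
    (h' : ∀ i, Commute (star (s i)) t) (i j : Fin 2) : Commute (cuntzMatrix s i j) t := by
  fin_cases i <;> fin_cases j
  · exact (((h 0).mul_left (h' 0)).mul_left (h' 0)).add_left ((h 1).mul_left (h' 1))
  · exact Commute.zero_left t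
  · exact ((h 0).mul_left (h' 1)).mul_left (h' 0)
  · exact h 1

lemma IsCuntzPair.cuntzMatrix_star_mul {s : Fin 2 → A} (hs : IsCuntzPair s) (i j : Fin 2) :
    ∑ k, star (cuntzMatrix s k i) * cuntzMatrix s k j = if i = j then 1 else 0 := by
  have hsum := hs.sum_mul_star
  rw [Fin.sum_univ_two] at hsum
  have hsum' (x : A) : s 0 * (s 0 * (star (s 0) * x)) + s 0 * (s 1 * (star (s 1) * x)) =
      s 0 * x := by
    rw [← mul_add, ← mul_assoc, ← mul_assoc (s 1), ← add_mul, hsum, one_mul]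
  rw [Fin.sum_univ_two]
  fin_cases i <;> fin_cases j <;>
    simp [cuntzMatrix, mul_assoc, hs.star_mul_assoc, hs.star_mul, mul_add, add_mul]
  rw [add_right_comm, hsum', hsum]

lemma IsCuntzPair.cuntzMatrix_mul_star {s : Fin 2 → A} (hs : IsCuntzPair s) (i j : Fin 2) :
    ∑ k, cuntzMatrix s i k * star (cuntzMatrix s j k) = if i = j then 1 else 0 := by
  have hsum := hs.sum_mul_star
  rw [Fin.sum_univ_two] at hsum
  rw [Fin.sum_univ_two]
  fin_cases i <;> fin_cases j <;>
    simp [cuntzMatrix, mul_assoc, hs.star_mul_assoc, mul_add, add_mul, hsum]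

lemma IsCuntzPair.cuntzMatrix_mul_apply_zero {s : Fin 2 → A} (hs : IsCuntzPair s) (i : Fin 2) :
    cuntzMatrix s i 0 * s 0 = s 0 * star (s i) := by
  fin_cases i <;> simp [cuntzMatrix, mul_assoc, hs.star_mul, add_mul]

lemma IsCuntzPair.cuntzMatrix_mul_cuntzMatrix {s t : Fin 2 → A} (hs : IsCuntzPair s)
    (ht : IsCuntzPair t) (hst : ∀ i j, Commute (s i) (t j)) (i j : Fin 2) :
    cuntzMatrix s i 0 * cuntzMatrix t j 0 * (s 0 * t 0) =
      s 0 * t 0 * (star (s i) * star (t j)) := by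
  have hts (k : Fin 2) : Commute (star (t k)) (s 0) :=
    ht.star_commute (fun l => (hst 0 l).symm) k
  have h1 : Commute (cuntzMatrix t j 0) (s 0) :=
    cuntzMatrix_commute (fun l => (hst 0 l).symm) hts j 0
  have h2 : Commute (star (s i)) (t 0) := hs.star_commute (fun l => hst l 0) i
  calc cuntzMatrix s i 0 * cuntzMatrix t j 0 * (s 0 * t 0)
      = cuntzMatrix s i 0 * (cuntzMatrix t j 0 * s 0) * t 0 := by simp only [mul_assoc]
    _ = (cuntzMatrix s i 0 * s 0) * (cuntzMatrix t j 0 * t 0) := by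
        rw [h1.eq]; simp only [mul_assoc]
    _ = s 0 * (star (s i) * t 0) * star (t j) := by
        rw [hs.cuntzMatrix_mul_apply_zero, ht.cuntzMatrix_mul_apply_zero]; simp only [mul_assoc]
    _ = s 0 * t 0 * (star (s i) * star (t j)) := by
        rw [h2.eq]; simp only [mul_assoc]

lemma IsCuntzPair.star_mul_star_mul {s t : Fin 2 → A} (hs : IsCuntzPair s)
    (ht : IsCuntzPair t) (hst : ∀ i j, Commute (s i) (t j)) (i j : Fin 2) :
    star (s i) * star (t j) * ∑ k, s k * t k = if i = j then 1 else 0 := by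
  have hts (k : Fin 2) : Commute (star (t j)) (s k) :=
    ht.star_commute (fun l => (hst k l).symm) j
  have h (k : Fin 2) : star (s i) * star (t j) * (s k * t k) =
      (star (s i) * s k) * (star (t j) * t k) := by
    rw [mul_assoc, ← mul_assoc (star (t j)), (hts k).eq]; simp only [mul_assoc]
  simp only [Finset.mul_sum, h, hs.star_mul, ht.star_mul]
  simp

lemma IsCuntzPair.norm_apply {H : Type*} [NormedAddCommGroup H] [InnerProductSpace ℂ H]
    [CompleteSpace H] {S : Fin 2 → (H →L[ℂ] H)} (hS : IsCuntzPair S) (i : Fin 2) (x : H) :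
    ‖S i x‖ = ‖x‖ :=
  (norm_map_iff_adjoint_comp_self (S i)).mpr ((hS.star_mul i i).trans (if_pos rfl)) x

end Embezzlement

/-- A perfect embezzlement protocol for a Bell state exists in the commuting operator
framework: there are a unit catalyst vector `ψ ∈ ℓ²(ℕ)` and *-commuting unitary operator
matrices `U`, `V` satisfying the perfect embezzlement relations for `ψ`. -/
theorem perfect_embezzlement_exists :
    ∃ (ψ : l2 ℕ) (U V : Fin 2 → Fin 2 → (l2 ℕ →L[ℂ] l2 ℕ)),
      ‖ψ‖ = 1 ∧
      IsUnitaryOpMatrix U ∧ IsUnitaryOpMatrix V ∧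
      StarCommuteFamilies U V ∧
      U 0 0 (V 0 0 ψ) = (1 / Real.sqrt 2 : ℂ) • ψ ∧
      U 1 0 (V 1 0 ψ) = (1 / Real.sqrt 2 : ℂ) • ψ ∧
      U 0 0 (V 1 0 ψ) = 0 ∧
      U 1 0 (V 0 0 ψ) = 0 := by
  obtain ⟨ψ, S, T, hψ, hS, hT, hST, hfix⟩ := exists_commuting_cuntz_pairs_l2
  have hfix' : (∑ k, S k * T k) ψ = (√2 : ℂ) • ψ := by
    rw [sum_apply]
    exact hfix
  have h2 : (√2 : ℂ) ≠ 0 := by simp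
  have hstar (i j : Fin 2) : (star (S i) * star (T j)) ψ =
      if i = j then (1 / √2 : ℂ) • ψ else 0 := by
    have h := congrArg (fun X : l2 ℕ →L[ℂ] l2 ℕ => X ψ) (hS.star_mul_star_mul hT hST i j)
    rw [mul_def, comp_apply, hfix', map_smul] at h
    rw [← inv_smul_smul₀ h2 ((star (S i) * star (T j)) ψ), h]
    split_ifs <;> simp
  have key (i j : Fin 2) : cuntzMatrix S i 0 (cuntzMatrix T j 0 ((S 0 * T 0) ψ)) =
      if i = j then (1 / √2 : ℂ) • (S 0 * T 0) ψ else 0 := by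
    have h := congrArg (fun X : l2 ℕ →L[ℂ] l2 ℕ => X ψ)
      (hS.cuntzMatrix_mul_cuntzMatrix hT hST i j)
    refine h.trans ?_
    change (S 0 * T 0) ((star (S i) * star (T j)) ψ) = _
    rw [hstar]
    split_ifs
    · rw [map_smul]
    · rw [map_zero]
  have hcomm (k l : Fin 2) (i : Fin 2) : Commute (S i) (cuntzMatrix T k l) :=
    (cuntzMatrix_commute (fun j => (hST i j).symm)
      (fun j => hT.star_commute (fun j => (hST i j).symm) j) k l).symm
  have hcomm' (k l : Fin 2) (i : Fin 2) : Commute (star (S i)) (cuntzMatrix T k l) :=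
    hS.star_commute (hcomm k l) i
  have hcommStar (k l : Fin 2) (i : Fin 2) : Commute (S i) (star (cuntzMatrix T k l)) := by
    simpa using (hcomm' k l i).star_star
  refine ⟨(S 0 * T 0) ψ, cuntzMatrix S, cuntzMatrix T, ?_,
    ⟨hS.cuntzMatrix_star_mul, hS.cuntzMatrix_mul_star⟩,
    ⟨hT.cuntzMatrix_star_mul, hT.cuntzMatrix_mul_star⟩, fun i j k l => ⟨?_, ?_⟩,
    key 0 0, key 1 1, key 0 1, key 1 0⟩
  · rw [mul_def, comp_apply, hS.norm_apply, hT.norm_apply, hψ]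
  · exact cuntzMatrix_commute (hcomm k l) (hcomm' k l) i j
  · have h := cuntzMatrix_commute (hcommStar k l)
      (fun i => hS.star_commute (hcommStar k l) i) i j
    have h' : Commute (star (cuntzMatrix S i j)) (cuntzMatrix T k l) := by
      simpa using h.star_star
    exact h'
end

section
/- For every d ≥ 1 and every family of coefficients α : Fin d → Fin d → ℂ with ∑ i j, ‖α i j‖² = 1, there exist a unit vector ψ ∈ ℓ²(ℕ) and families U, V : Fin d → Fin d → (ℓ²(ℕ) →L[ℂ] ℓ²(ℕ)) of bounded operators such that U and V are unitary operator matrices, the families U and V *-commute, and for all i, j ∈ Fin d: U i 0 (V j 0 ψ) = (α i j) • ψ. (Every entangled state ∑ α_{ij} |i⟩⊗|j⟩ of two d-level systems can be perfectly embezzled in the commuting operator framework.) -/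
section
universe u
open scoped ComplexOrder InnerProductSpace
open TopologicalSpace

theorem exists_separable_gns_representation {A : Type u} [CStarAlgebra A] [SeparableSpace A]
    (f : A →ₗ[ℂ] ℂ) (hf : ∀ a, 0 ≤ f (star a * a)) :
    ∃ (H : Type u) (_ : NormedAddCommGroup H) (_ : InnerProductSpace ℂ H) (_ : CompleteSpace H)
      (_ : SeparableSpace H) (π : A →⋆ₐ[ℂ] (H →L[ℂ] H)) (Ω : H),
      ∀ a, ((‖π a Ω‖ ^ 2 : ℝ) : ℂ) = f (star a * a) := by
  let _ := CStarAlgebra.spectralOrder A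
  have := CStarAlgebra.spectralOrderedRing A
  let F : A →ₚ[ℂ] ℂ := PositiveLinearMap.mk₀ f fun x hx => by
    obtain ⟨b, rfl⟩ := CStarAlgebra.nonneg_iff_eq_star_mul_self.mp hx
    exact hf b
  have hsep : SeparableSpace F.PreGNS := by
    have hcont : Continuous F.toPreGNS := by
      refine AddMonoidHomClass.continuous_of_bound F.toPreGNS ‖F.toPreGNS 1‖ fun a => ?_
      have h := (F.leftMulMapPreGNS a).le_opNorm (F.toPreGNS 1)
      have h' : ‖F.leftMulMapPreGNS a‖ ≤ ‖a‖ := LinearMap.mkContinuous_norm_le _ (norm_nonneg _) _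
      rw [PositiveLinearMap.leftMulMapPreGNS_apply, PositiveLinearMap.ofPreGNS_toPreGNS,
        mul_one] at h
      rw [mul_comm]
      exact h.trans (by gcongr)
    exact F.toPreGNS.surjective.denseRange.separableSpace hcont
  refine ⟨F.GNS, inferInstance, inferInstance, inferInstance, inferInstance, F.gnsStarAlgHom,
    (F.toPreGNS 1 : F.PreGNS), fun a => ?_⟩
  have : F.gnsStarAlgHom a ((F.toPreGNS 1 : F.PreGNS) : F.GNS) = (F.toPreGNS a : F.PreGNS) := by
    exact (F.gnsNonUnitalStarAlgHom_apply_coe).trans (by simp)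
  rw [this, UniformSpace.Completion.norm_coe, Complex.ofReal_pow, F.preGNS_norm_sq]
  rfl

theorem Orthonormal.countable_of_separableSpace {𝕜 E ι : Type*} [RCLike 𝕜]
    [NormedAddCommGroup E] [InnerProductSpace 𝕜 E] [SeparableSpace E] {v : ι → E}
    (hv : Orthonormal 𝕜 v) : Countable ι := by
  have hball : Pairwise (Function.onFun Disjoint fun i => Metric.ball (v i) (1 / 2)) := by
    intro i j hij
    refine Metric.ball_disjoint_ball ?_
    have h : ‖v i - v j‖ ^ 2 = 2 := by
      rw [@norm_sub_sq 𝕜, hv.2 hij, hv.1 i, hv.1 j]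
      norm_num
    rw [dist_eq_norm]
    nlinarith [norm_nonneg (v i - v j)]
  exact hball.countable_of_isOpen_disjoint (fun _ => Metric.isOpen_ball)
    fun i => ⟨v i, Metric.mem_ball_self (by norm_num)⟩

theorem nonempty_linearIsometryEquiv_l2_nat {H : Type*} [NormedAddCommGroup H]
    [InnerProductSpace ℂ H] [CompleteSpace H] [SeparableSpace H]
    (hH : ¬ FiniteDimensional ℂ H) : Nonempty (H ≃ₗᵢ[ℂ] l2 ℕ) := by
  obtain ⟨w, b, -⟩ := exists_hilbertBasis ℂ H
  have : Countable w := b.orthonormal.countable_of_separableSpace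
  have : Infinite w := by
    by_contra hfin
    rw [not_infinite_iff_finite] at hfin
    have := Fintype.ofFinite w
    exact hH b.toOrthonormalBasis.toBasis.finiteDimensional_of_finite
  obtain ⟨e⟩ := nonempty_equiv_of_countable (α := ℕ) (β := w)
  have hb : Orthonormal ℂ (b ∘ e) := b.orthonormal.comp _ e.injective
  exact ⟨(HilbertBasis.mk hb (by
    rw [Set.range_comp, e.range_eq_univ, Set.image_univ, b.dense_span])).repr⟩

theorem exists_representation_l2_nat {A : Type u} [CStarAlgebra A] [SeparableSpace A]
    (f : A →ₗ[ℂ] ℂ) (hf : ∀ a, 0 ≤ f (star a * a)) {r : A} (hr : star r * r = 1)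
    (hr' : f (r * star r) ≠ f 1) :
    ∃ (π : A →⋆ₐ[ℂ] (l2 ℕ →L[ℂ] l2 ℕ)) (Ω : l2 ℕ),
      ∀ a, ((‖π a Ω‖ ^ 2 : ℝ) : ℂ) = f (star a * a) := by
  obtain ⟨H, _, _, _, _, π, Ω, hΩ⟩ := exists_separable_gns_representation f hf
  have hH : ¬ FiniteDimensional ℂ H := by
    intro hfin
    have h1 : π (star r) * π r = 1 := by rw [← map_mul, hr, map_one]
    have h2 : π r * π (star r) = 1 := by
      have h : (π (star r)).toLinearMap * (π r).toLinearMap = 1 :=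
        congrArg ContinuousLinearMap.toLinearMap h1
      exact ContinuousLinearMap.coe_injective (mul_eq_one_comm.mp h)
    have h3 : ‖π (star r) Ω‖ = ‖Ω‖ := by
      rw [← sq_eq_sq₀ (norm_nonneg _) (norm_nonneg _), ← @inner_self_eq_norm_sq ℂ,
        ← @inner_self_eq_norm_sq ℂ, map_star, ContinuousLinearMap.star_eq_adjoint,
        ContinuousLinearMap.adjoint_inner_left, ← ContinuousLinearMap.star_eq_adjoint, ← map_star,
        ← mul_apply_eq_comp, h2, one_apply_eq_self]
    have h4 := hΩ (star r)
    have h5 := hΩ 1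
    rw [h3, star_star] at h4
    rw [map_one, one_apply_eq_self, star_one, one_mul] at h5
    exact hr' (h4.symm.trans h5)
  obtain ⟨e⟩ := nonempty_linearIsometryEquiv_l2_nat hH
  refine ⟨(StarAlgHomClass.toStarAlgHom e.conjStarAlgEquiv).comp π, e Ω, fun a => ?_⟩
  rw [← hΩ a]
  simp
end

section
open scoped ComplexOrder InnerProductSpace
open TopologicalSpace Filter Topology

theorem exists_limit_vector_state {K : Type*} [NormedAddCommGroup K] [InnerProductSpace ℂ K]
    (ψ : ℕ → K) (hψ : ∀ n, ‖ψ n‖ = 1) :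
    ∃ f : (K →L[ℂ] K) →ₗ[ℂ] ℂ, ∀ a : K →L[ℂ] K,
      Tendsto (fun n => ⟪ψ n, a (ψ n)⟫_ℂ) (hyperfilter ℕ) (𝓝 (f a)) := by
  have hex : ∀ a : K →L[ℂ] K, ∃ z : ℂ,
      Tendsto (fun n => ⟪ψ n, a (ψ n)⟫_ℂ) (hyperfilter ℕ) (𝓝 z) := by
    intro a
    have hmem : ∀ n, ⟪ψ n, a (ψ n)⟫_ℂ ∈ Metric.closedBall (0 : ℂ) ‖a‖ := by
      intro n
      rw [mem_closedBall_zero_iff]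
      refine (norm_inner_le_norm _ _).trans ?_
      simpa [hψ n] using a.le_opNorm (ψ n)
    obtain ⟨z, -, hz⟩ := (isCompact_closedBall (0 : ℂ) ‖a‖).ultrafilter_le_nhds'
      ((hyperfilter ℕ).map fun n => ⟪ψ n, a (ψ n)⟫_ℂ) (mem_map.mpr (univ_mem' hmem))
    exact ⟨z, hz⟩
  choose f hf using hex
  refine ⟨{ toFun := f, map_add' := fun a b => ?_, map_smul' := fun c a => ?_ }, hf⟩
  · refine tendsto_nhds_unique (hf (a + b)) (((hf a).add (hf b)).congr fun n => ?_)
    simp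
  · refine tendsto_nhds_unique (hf (c • a)) (((hf a).const_smul c).congr fun n => ?_)
    simp

theorem Set.Countable.submonoidClosure {M : Type*} [Monoid M] {s : Set M} (hs : s.Countable) :
    (Submonoid.closure s : Set M).Countable := by
  have := hs.to_subtype
  have : Countable (FreeMonoid s) := inferInstanceAs (Countable (List s))
  rw [Submonoid.closure_eq_mrange, MonoidHom.coe_mrange]
  exact Set.countable_range _

theorem Set.Countable.isSeparable_starAdjoin {A : Type*} [CStarAlgebra A] {s : Set A}
    (hs : s.Countable) : IsSeparable (StarAlgebra.adjoin ℂ s : Set A) := by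
  have h := (hs.union (by simpa using hs.image star : (star s).Countable)).submonoidClosure
  have h' := h.isSeparable.span (R := ℂ)
  rwa [← StarAlgebra.adjoin_eq_span] at h'

theorem exists_limit_representation {K : Type*} [NormedAddCommGroup K] [InnerProductSpace ℂ K]
    [CompleteSpace K] (ψ : ℕ → K) (hψ : ∀ n, ‖ψ n‖ = 1) {s : Set (K →L[ℂ] K)} (hs : s.Countable)
    {r : K →L[ℂ] K} (hrs : r ∈ s) (hr : star r * r = 1) (hrψ : ∀ n, star r (ψ n) = 0) :
    ∃ (B : StarSubalgebra ℂ (K →L[ℂ] K)) (_ : s ⊆ B) (π : B →⋆ₐ[ℂ] (l2 ℕ →L[ℂ] l2 ℕ))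
      (Ω : l2 ℕ), ‖Ω‖ = 1 ∧
      ∀ a : B, Tendsto (fun n => ‖(a : K →L[ℂ] K) (ψ n)‖) atTop (𝓝 0) → π a Ω = 0 := by
  obtain ⟨f, hf⟩ := exists_limit_vector_state ψ hψ
  have hsq : ∀ a : K →L[ℂ] K,
      Tendsto (fun n => ((‖a (ψ n)‖ ^ 2 : ℝ) : ℂ)) (hyperfilter ℕ) (𝓝 (f (star a * a))) := by
    refine fun a => (hf (star a * a)).congr fun n => ?_
    rw [mul_apply_eq_comp, ContinuousLinearMap.star_eq_adjoint,
      ContinuousLinearMap.adjoint_inner_right, inner_self_eq_norm_sq_to_K]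
    simp
  have hpos : ∀ a, 0 ≤ f (star a * a) := fun a =>
    ge_of_tendsto (hsq a) (Eventually.of_forall fun n => by
      rw [Complex.zero_le_real]; positivity)
  have hf1 : f 1 = 1 := by
    have h := hsq 1
    simp only [one_apply_eq_self, hψ, star_one, one_mul] at h
    simpa using (tendsto_nhds_unique tendsto_const_nhds h).symm
  have hfr : f (r * star r) = 0 := by
    have h := hsq (star r)
    simp only [hrψ, star_star] at h
    simpa using (tendsto_nhds_unique tendsto_const_nhds h).symm
  let B := (StarAlgebra.adjoin ℂ s).topologicalClosure
  have hsB : s ⊆ B :=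
    (StarAlgebra.subset_adjoin ℂ s).trans (StarSubalgebra.le_topologicalClosure _)
  have hclosed : IsClosed (B : Set (K →L[ℂ] K)) := StarSubalgebra.isClosed_topologicalClosure _
  have hsep : SeparableSpace B := by
    have : IsSeparable (B : Set (K →L[ℂ] K)) := hs.isSeparable_starAdjoin.closure
    exact this.separableSpace
  obtain ⟨π, Ω, hΩ⟩ := exists_representation_l2_nat (A := B)
    (f ∘ₗ B.subtype.toAlgHom.toLinearMap) (fun a => hpos a) (r := ⟨r, hsB hrs⟩)
    (Subtype.ext hr) (by
      change f (r * star r) ≠ f 1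
      rw [hfr, hf1]
      exact zero_ne_one)
  refine ⟨B, hsB, π, Ω, ?_, fun a ha => ?_⟩
  · have h := hΩ 1
    have h' : ((‖Ω‖ ^ 2 : ℝ) : ℂ) = f (star 1 * 1) := by simpa using h
    rw [star_one, one_mul, hf1, Complex.ofReal_eq_one] at h'
    exact (pow_eq_one_iff_of_nonneg (norm_nonneg Ω) two_ne_zero).mp h'
  · have h0 : f (star (a : K →L[ℂ] K) * a) = 0 := by
      refine tendsto_nhds_unique (hsq a) ?_
      have h := (Complex.continuous_ofReal.tendsto _).comp
        ((ha.pow 2).mono_left Nat.hyperfilter_le_atTop)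
      simpa [Function.comp_def] using h
    have h : ((‖π a Ω‖ ^ 2 : ℝ) : ℂ) = 0 := (hΩ a).trans h0
    simpa using h
end

section
open scoped InnerProductSpace
open Filter Topology Function

/-- A family of isometries with mutually orthogonal ranges adding up to the identity. -/
structure IsCuntzFamily {ι A : Type*} [Fintype ι] [DecidableEq ι] [Semiring A] [StarRing A]
    (s : ι → A) : Prop where
  star_mul_eq_ite : ∀ i j, star (s i) * s j = if i = j then 1 else 0
  sum_mul_star : ∑ i, s i * star (s i) = 1

/-- Two families in a star ring such that each member of the first commutes with every member of
the second and with its adjoint. -/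
def StarCommuting {ι κ A : Type*} [Mul A] [Star A] (s : ι → A) (t : κ → A) : Prop :=
  ∀ i j, Commute (s i) (t j) ∧ Commute (star (s i)) (t j)

section Algebra

variable {ι A : Type*}

theorem IsCuntzFamily.sum_star_mul_mul_star [Fintype ι] [DecidableEq ι] [Semiring A]
    [StarRing A] {s s' : ι → A} (hs : IsCuntzFamily s) (hs' : IsCuntzFamily s') (i j : ι) :
    ∑ k, star (s' i * star (s k)) * (s' j * star (s k)) = if i = j then 1 else 0 := by
  have h : ∀ k, star (s' i * star (s k)) * (s' j * star (s k))
      = if i = j then s k * star (s k) else 0 := by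
    intro k
    rw [star_mul, star_star, mul_assoc, ← mul_assoc (star (s' i)), hs'.star_mul_eq_ite]
    split_ifs <;> simp
  rw [Finset.sum_congr rfl fun k _ => h k]
  split_ifs
  · exact hs.sum_mul_star
  · simp

theorem IsCuntzFamily.sum_mul_star_mul_star [Fintype ι] [DecidableEq ι] [Semiring A]
    [StarRing A] {s s' : ι → A} (hs : IsCuntzFamily s) (hs' : IsCuntzFamily s') (i j : ι) :
    ∑ k, (s' k * star (s i)) * star (s' k * star (s j)) = if i = j then 1 else 0 := by
  simpa using hs'.sum_star_mul_mul_star hs i j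

theorem StarCommuting.commute_star_right {κ : Type*} [Semiring A] [StarRing A] {s : ι → A}
    {t : κ → A} (h : StarCommuting s t) (i : ι) (j : κ) : Commute (s i) (star (t j)) := by
  simpa using (h i j).2.star_star

theorem StarCommuting.commute_star_star {κ : Type*} [Semiring A] [StarRing A] {s : ι → A}
    {t : κ → A} (h : StarCommuting s t) (i : ι) (j : κ) : Commute (star (s i)) (star (t j)) :=
  (h i j).1.star_star

end Algebra

section Composition

variable {X : Type*}

/-- Composition with an injective map, as a contraction of `ℓ²(X)`. -/
noncomputable def l2Comp (g : X ↪ X) : l2 X →L[ℂ] l2 X :=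
  LinearMap.mkContinuous
    { toFun := fun f => ⟨fun x => f (g x), memℓp_gen
        (((lp.memℓp f).summable (by norm_num)).comp_injective g.injective)⟩
      map_add' := fun _ _ => rfl
      map_smul' := fun _ _ => rfl } 1 fun f => by
    rw [one_mul]
    refine lp.norm_le_of_tsum_le (by norm_num) (norm_nonneg f) ?_
    rw [lp.norm_rpow_eq_tsum (by norm_num) f]
    exact tsum_comp_le_tsum_of_inj ((lp.memℓp f).summable (by norm_num))
      (fun _ => by positivity) g.injective

@[simp]
theorem l2Comp_apply (g : X ↪ X) (f : l2 X) (x : X) : l2Comp g f x = f (g x) := rfl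

/-- The isometry of `ℓ²(X)` which relabels the standard basis along an injective map. -/
noncomputable def l2Push (g : X ↪ X) : l2 X →L[ℂ] l2 X := star (l2Comp g)

@[simp]
theorem star_l2Push (g : X ↪ X) : star (l2Push g) = l2Comp g := star_star _

theorem l2Push_apply_eq_inner [DecidableEq X] (g : X ↪ X) (f : l2 X) (x : X) :
    l2Push g f x = ⟪l2Comp g (lp.single 2 x (1 : ℂ)), f⟫_ℂ := by
  rw [← ContinuousLinearMap.adjoint_inner_right, ← ContinuousLinearMap.star_eq_adjoint,
    lp.inner_single_left]
  simp [l2Push]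

@[simp]
theorem l2Push_apply_map (g : X ↪ X) (f : l2 X) (x : X) : l2Push g f (g x) = f x := by
  classical
  have h : l2Comp g (lp.single 2 (g x) (1 : ℂ)) = lp.single 2 x (1 : ℂ) := by
    ext y
    simp [Pi.single_apply]
  rw [l2Push_apply_eq_inner, h, lp.inner_single_left]
  simp

theorem l2Push_apply_of_notMem_range (g : X ↪ X) (f : l2 X) {x : X} (hx : x ∉ Set.range g) :
    l2Push g f x = 0 := by
  classical
  have h : l2Comp g (lp.single 2 x (1 : ℂ)) = 0 := by
    ext y
    have : g y ≠ x := fun h => hx ⟨y, h⟩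
    simp [this]
  rw [l2Push_apply_eq_inner, h, inner_zero_left]

theorem exists_of_l2Push_apply_ne_zero {g : X ↪ X} {f : l2 X} {x : X} (hx : l2Push g f x ≠ 0) :
    ∃ y, g y = x ∧ f y ≠ 0 := by
  by_cases h : x ∈ Set.range g
  · obtain ⟨y, rfl⟩ := h
    exact ⟨y, rfl, by simpa using hx⟩
  · exact absurd (l2Push_apply_of_notMem_range g f h) hx

theorem l2Push_eq_self {g : X ↪ X} {f : l2 X} (h : ∀ x, f x ≠ 0 → g x = x) :
    l2Push g f = f := by
  ext x
  by_cases hx : x ∈ Set.range g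
  · obtain ⟨y, rfl⟩ := hx
    rw [l2Push_apply_map]
    by_cases hy : f (g y) = 0
    · by_contra hne
      rw [hy] at hne
      exact hne (h y hne ▸ hy)
    · rw [g.injective (h _ hy)]
  · rw [l2Push_apply_of_notMem_range g f hx]
    by_contra hne
    exact hx ⟨x, h x (Ne.symm hne)⟩

theorem star_l2Push_apply_eq_zero {g : X ↪ X} {f : l2 X} (hf : ∀ x, f (g x) = 0) :
    star (l2Push g) f = 0 := by
  rw [star_l2Push]
  ext x
  exact (l2Comp_apply g f x).trans (hf x)

theorem l2Comp_mul_l2Push_self (g : X ↪ X) : l2Comp g * l2Push g = 1 := by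
  ext f x
  simp

theorem l2Comp_mul_l2Push_of_disjoint {g h : X ↪ X} (hgh : ∀ x y, g x ≠ h y) :
    l2Comp g * l2Push h = 0 := by
  ext f x
  simpa using l2Push_apply_of_notMem_range h f (x := g x) fun ⟨y, hy⟩ => hgh x y hy.symm

theorem l2Comp_mul_l2Push_comm {g h : X ↪ X} (hcomm : ∀ x, g (h x) = h (g x))
    (hpull : ∀ x y, g x = h y → x ∈ Set.range h) : Commute (l2Comp g) (l2Push h) := by
  ext f x
  simp only [mul_apply_eq_comp, l2Comp_apply]
  by_cases hx : x ∈ Set.range h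
  · obtain ⟨y, rfl⟩ := hx
    rw [hcomm, l2Push_apply_map, l2Push_apply_map, l2Comp_apply]
  · rw [l2Push_apply_of_notMem_range h _ hx, l2Push_apply_of_notMem_range h f]
    rintro ⟨y, hy⟩
    exact hx (hpull x y hy.symm)

theorem l2Push_commute {g h : X ↪ X} (hcomm : ∀ x, g (h x) = h (g x)) :
    Commute (l2Push g) (l2Push h) := by
  have : Commute (l2Comp g) (l2Comp h) := by
    ext f x
    simp [hcomm]
  exact this.star_star

theorem isCuntzFamily_l2Push {ι : Type*} [Fintype ι] [DecidableEq ι] {g : ι → X ↪ X}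
    (hg : Bijective fun p : ι × X => g p.1 p.2) : IsCuntzFamily fun i => l2Push (g i) where
  star_mul_eq_ite i j := by
    rw [star_l2Push]
    split_ifs with h
    · rw [h, l2Comp_mul_l2Push_self]
    · refine l2Comp_mul_l2Push_of_disjoint fun x y hxy => h ?_
      exact congrArg Prod.fst (hg.1 (a₁ := (i, x)) (a₂ := (j, y)) hxy)
  sum_mul_star := by
    ext f x
    obtain ⟨⟨i, y⟩, rfl⟩ := hg.2 x
    simp only [star_l2Push, sum_apply, lp.coeFn_sum, Finset.sum_apply,
      mul_apply_eq_comp, one_apply_eq_self]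
    rw [Finset.sum_eq_single i]
    · simp
    · intro j _ hji
      refine l2Push_apply_of_notMem_range _ _ ?_
      rintro ⟨z, hz⟩
      exact hji (congrArg Prod.fst (hg.1 (a₁ := (j, z)) (a₂ := (i, y)) hz))
    · simp

end Composition

section Product

variable {Y Z ι κ : Type*}

/-- The isometry of `ℓ²(Y × Z)` acting on the first factor. -/
noncomputable def l2PushFst (Z : Type*) (g : Y ↪ Y) : l2 (Y × Z) →L[ℂ] l2 (Y × Z) :=
  l2Push (g.prodMap (Embedding.refl Z))

/-- The isometry of `ℓ²(Y × Z)` acting on the second factor. -/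
noncomputable def l2PushSnd (Y : Type*) (h : Z ↪ Z) : l2 (Y × Z) →L[ℂ] l2 (Y × Z) :=
  l2Push ((Embedding.refl Y).prodMap h)

theorem starCommuting_l2PushFst_l2PushSnd (g : ι → Y ↪ Y) (h : κ → Z ↪ Z) :
    StarCommuting (fun i => l2PushFst Z (g i)) (fun j => l2PushSnd Y (h j)) := by
  refine fun i j => ⟨l2Push_commute fun _ => rfl, ?_⟩
  simp only [l2PushFst, l2PushSnd, star_l2Push]
  refine l2Comp_mul_l2Push_comm (fun _ => rfl) ?_
  rintro ⟨y, z⟩ ⟨y', z'⟩ hxy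
  exact ⟨(y, z'), by simpa using (congrArg Prod.snd hxy).symm⟩

variable [Fintype ι] [DecidableEq ι]

theorem isCuntzFamily_l2PushFst {g : ι → Y ↪ Y} (hg : Bijective fun p : ι × Y => g p.1 p.2) :
    IsCuntzFamily fun i => l2PushFst Z (g i) := by
  refine isCuntzFamily_l2Push ⟨?_, ?_⟩
  · rintro ⟨i, y, z⟩ ⟨i', y', z'⟩ h
    have h1 := hg.1 (a₁ := (i, y)) (a₂ := (i', y')) (congrArg Prod.fst h)
    have h2 : z = z' := congrArg Prod.snd h
    simp_all
  · rintro ⟨y, z⟩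
    obtain ⟨⟨i, y'⟩, rfl⟩ := hg.2 y
    exact ⟨(i, y', z), rfl⟩

theorem isCuntzFamily_l2PushSnd {h : ι → Z ↪ Z} (hh : Bijective fun p : ι × Z => h p.1 p.2) :
    IsCuntzFamily fun i => l2PushSnd Y (h i) := by
  refine isCuntzFamily_l2Push ⟨?_, ?_⟩
  · rintro ⟨i, y, z⟩ ⟨i', y', z'⟩ hyz
    have h1 := hh.1 (a₁ := (i, z)) (a₂ := (i', z')) (congrArg Prod.snd hyz)
    have h2 : y = y' := congrArg Prod.fst hyz
    simp_all
  · rintro ⟨y, z⟩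
    obtain ⟨⟨i, z'⟩, rfl⟩ := hh.2 z
    exact ⟨(i, y, z'), rfl⟩

end Product
end

section
open scoped InnerProductSpace
open Filter Topology Function

theorem tendsto_norm_apply_normalized_sum {K : Type*} [NormedAddCommGroup K]
    [InnerProductSpace ℂ K] {ξ : ℕ → K} (hξ : ∀ k, ‖ξ k‖ = 1) {T : K →L[ℂ] K} {c : ℂ}
    (hT : ∀ k, T (ξ (k + 1)) = c • ξ k) :
    Tendsto (fun n : ℕ => ‖(T - c • 1)
      (((√(n + 1 : ℝ))⁻¹ : ℂ) • ∑ k ∈ Finset.range (n + 1), ξ k)‖) atTop (𝓝 0) := by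
  have hsum : ∀ n, (T - c • 1) (∑ k ∈ Finset.range (n + 1), ξ k) = T (ξ 0) - c • ξ n := by
    intro n
    rw [sub_apply, map_sum, Finset.sum_range_succ', Finset.sum_congr rfl fun k _ => hT k,
      smul_apply, one_apply_eq_self, Finset.sum_range_succ, smul_add, Finset.smul_sum]
    abel
  have hbound : ∀ n : ℕ, ‖(T - c • 1)
      (((√(n + 1 : ℝ))⁻¹ : ℂ) • ∑ k ∈ Finset.range (n + 1), ξ k)‖
        ≤ (√(n + 1 : ℝ))⁻¹ * (‖T (ξ 0)‖ + ‖c‖) := by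
    intro n
    rw [map_smul, hsum, norm_smul, norm_inv, Complex.norm_real, Real.norm_eq_abs,
      abs_of_nonneg (Real.sqrt_nonneg _)]
    gcongr
    refine (norm_sub_le _ _).trans ?_
    rw [norm_smul, hξ, mul_one]
  refine squeeze_zero (fun _ => norm_nonneg _) hbound ?_
  have h : Tendsto (fun n : ℕ => √(n + 1 : ℝ)) atTop atTop :=
    Real.tendsto_sqrt_atTop.comp (tendsto_natCast_atTop_atTop.atTop_add tendsto_const_nhds)
  simpa using h.inv_tendsto_atTop.mul_const (‖T (ξ 0)‖ + ‖c‖)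

theorem Orthonormal.norm_normalized_sum {K : Type*} [NormedAddCommGroup K]
    [InnerProductSpace ℂ K] {ξ : ℕ → K} (hξ : Orthonormal ℂ ξ) (n : ℕ) :
    ‖((√(n + 1 : ℝ))⁻¹ : ℂ) • ∑ k ∈ Finset.range (n + 1), ξ k‖ = 1 := by
  have h : ‖∑ k ∈ Finset.range (n + 1), ξ k‖ ^ 2 = (n + 1 : ℝ) := by
    have := hξ.inner_sum (fun _ => 1) (fun _ => 1) (Finset.range (n + 1))
    simp only [one_smul, map_one, mul_one, Finset.sum_const, Finset.card_range,
      inner_self_eq_norm_sq_to_K, nsmul_eq_mul, RCLike.ofReal_eq_complex_ofReal] at this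
    exact_mod_cast this
  rw [norm_smul, norm_inv, Complex.norm_real, Real.norm_eq_abs, abs_of_nonneg (Real.sqrt_nonneg _),
    ← h, Real.sqrt_sq (norm_nonneg _), inv_mul_cancel₀]
  intro h0
  rw [h0] at h
  norm_num at h
  linarith [(Nat.cast_nonneg n : (0 : ℝ) ≤ n)]

section Words

variable {K : Type*} [NormedAddCommGroup K] [InnerProductSpace ℂ K] [CompleteSpace K] {d : ℕ}

/-- The vectors `∑ α_{i₁j₁} ⋯ α_{iₖjₖ} s_{i₁} t_{j₁} ⋯ s_{iₖ} t_{jₖ} ξ₀`. -/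
noncomputable def wordVector (α : Fin d → Fin d → ℂ) (s t : Fin d → K →L[ℂ] K) (ξ₀ : K) : ℕ → K
  | 0 => ξ₀
  | k + 1 => ∑ i, ∑ j, α i j • s i (t j (wordVector α s t ξ₀ k))

variable {α : Fin d → Fin d → ℂ} {s t : Fin d → K →L[ℂ] K} {ξ₀ : K}

theorem star_apply_star_apply_wordVector_succ (hs : IsCuntzFamily s) (ht : IsCuntzFamily t)
    (hst : StarCommuting s t) (i j : Fin d) (k : ℕ) :
    star (s i) (star (t j) (wordVector α s t ξ₀ (k + 1))) = α i j • wordVector α s t ξ₀ k := by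
  have h : ∀ i' j', star (s i) * star (t j) * (s i' * t j') =
      if i = i' then if j = j' then 1 else 0 else 0 := by
    intro i' j'
    rw [mul_assoc, ← mul_assoc (star (t j)), ← (hst.commute_star_right i' j).eq, mul_assoc,
      ht.star_mul_eq_ite, ← mul_assoc, hs.star_mul_eq_ite]
    split_ifs <;> simp
  have h' : ∀ i' j' x, star (s i) (star (t j) (s i' (t j' x))) =
      if i = i' then if j = j' then x else 0 else 0 := by
    intro i' j' x
    have := congrArg (fun T : K →L[ℂ] K => T x) (h i' j')
    split_ifs at this ⊢ <;> simpa using this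
  simp [wordVector, map_sum, h']

theorem norm_wordVector (hα : ∑ i, ∑ j, ‖α i j‖ ^ 2 = 1) (hs : IsCuntzFamily s)
    (ht : IsCuntzFamily t) (hst : StarCommuting s t) (hξ₀ : ‖ξ₀‖ = 1) (k : ℕ) :
    ‖wordVector α s t ξ₀ k‖ = 1 := by
  induction k with
  | zero => exact hξ₀
  | succ k ih =>
    have h : ⟪wordVector α s t ξ₀ (k + 1), wordVector α s t ξ₀ (k + 1)⟫_ℂ = 1 := by
      nth_rewrite 1 [wordVector]
      have hin : ∀ i j, ⟪α i j • s i (t j (wordVector α s t ξ₀ k)),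
          wordVector α s t ξ₀ (k + 1)⟫_ℂ = ((‖α i j‖ ^ 2 : ℝ) : ℂ) := by
        intro i j
        have hc := star_apply_star_apply_wordVector_succ (α := α) (ξ₀ := ξ₀) hs ht hst i j k
        rw [← mul_apply_eq_comp, (hst.commute_star_star i j).eq, mul_apply_eq_comp] at hc
        rw [inner_smul_left, ← ContinuousLinearMap.adjoint_inner_right,
          ← ContinuousLinearMap.adjoint_inner_right, ← ContinuousLinearMap.star_eq_adjoint,
          ← ContinuousLinearMap.star_eq_adjoint, hc, inner_smul_right,
          inner_self_eq_norm_sq_to_K, ih]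
        simp [Complex.conj_mul']
      simp only [sum_inner, hin]
      exact_mod_cast hα
    rw [inner_self_eq_norm_sq_to_K, RCLike.ofReal_eq_complex_ofReal] at h
    exact (pow_eq_one_iff_of_nonneg (norm_nonneg _) two_ne_zero).mp (by exact_mod_cast h)

end Words

section Registers

variable {d : ℕ}

/-- Appending a least significant base-`d` digit. -/
def digitCons (i : Fin d) : ℕ ↪ ℕ where
  toFun n := d * n + i
  inj' _ _ h := Nat.eq_of_mul_eq_mul_left i.pos (Nat.add_right_cancel h)

theorem bijective_digitCons (hd : 1 ≤ d) :
    Bijective fun p : Fin d × ℕ => digitCons p.1 p.2 := by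
  refine ⟨?_, fun n => ⟨(⟨n % d, Nat.mod_lt n hd⟩, n / d), Nat.div_add_mod n d⟩⟩
  rintro ⟨i, m⟩ ⟨j, n⟩ h
  have h : d * m + i = d * n + j := h
  have h1 := congrArg (· % d) h
  have h2 := congrArg (· / d) h
  simp only [Nat.mul_add_mod, Nat.mod_eq_of_lt i.2, Nat.mod_eq_of_lt j.2] at h1
  simp only [Nat.mul_add_div hd, Nat.div_eq_of_lt i.2, Nat.div_eq_of_lt j.2, add_zero] at h2
  exact Prod.ext (Fin.ext h1) h2

variable {L R : Type*}

theorem bijective_prodMap_right {g : Fin d → R ↪ R} (hg : Bijective fun p : Fin d × R => g p.1 p.2)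
    (e : L ≃ L) : Bijective fun p : Fin d × (L × R) => (e.toEmbedding.prodMap (g p.1)) p.2 := by
  constructor
  · rintro ⟨i, l, r⟩ ⟨i', l', r'⟩ h
    have h1 := hg.1 (a₁ := (i, r)) (a₂ := (i', r')) (congrArg Prod.snd h)
    have h2 : l = l' := e.injective (congrArg Prod.fst h)
    simp_all
  · rintro ⟨l, r⟩
    obtain ⟨⟨i, r'⟩, rfl⟩ := hg.2 r
    exact ⟨(i, e.symm l, r'), Prod.ext (e.apply_symm_apply l) rfl⟩

theorem bijective_prodMap_left {g : Fin d → L ↪ L} (hg : Bijective fun p : Fin d × L => g p.1 p.2) :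
    Bijective fun p : Fin d × (L × R) => ((g p.1).prodMap (Embedding.refl R)) p.2 := by
  constructor
  · rintro ⟨i, l, r⟩ ⟨i', l', r'⟩ h
    have h1 := hg.1 (a₁ := (i, l)) (a₂ := (i', l')) (congrArg Prod.fst h)
    have h2 : r = r' := congrArg Prod.snd h
    simp_all
  · rintro ⟨l, r⟩
    obtain ⟨⟨i, l'⟩, rfl⟩ := hg.2 l
    exact ⟨(i, l', r), rfl⟩

/-- Labels of one party's memory: a store for incoming digits, a counter, and a store from which
digits are emitted. The counter records how many digits have been put into the last store. -/
abbrev Memory := ℕ × ℤ × ℕ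

/-- Storing an incoming digit. -/
def storeDigit (i : Fin d) : Memory ↪ Memory := (digitCons i).prodMap (Embedding.refl _)

/-- The inverse of emitting a digit. -/
def supplyDigit (i : Fin d) : Memory ↪ Memory :=
  (Equiv.refl ℕ).toEmbedding.prodMap ((Equiv.addRight (1 : ℤ)).toEmbedding.prodMap (digitCons i))

theorem bijective_storeDigit (hd : 1 ≤ d) :
    Bijective fun p : Fin d × Memory => storeDigit p.1 p.2 :=
  bijective_prodMap_left (bijective_digitCons hd)

theorem bijective_supplyDigit (hd : 1 ≤ d) :
    Bijective fun p : Fin d × Memory => supplyDigit p.1 p.2 :=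
  bijective_prodMap_right (g := fun i => (Equiv.addRight (1 : ℤ)).toEmbedding.prodMap (digitCons i))
    (bijective_prodMap_right (bijective_digitCons hd) (Equiv.addRight (1 : ℤ))) (Equiv.refl ℕ)

/-- A shift of the store for incoming digits. -/
def shiftStore : Memory ↪ Memory :=
  (addRightEmbedding 1).prodMap (Embedding.refl _)

/-- The vectors which hold `k` copies of the state with coefficient matrix `α`, the remaining
digits being zero. -/
noncomputable def copies (α : Fin d → Fin d → ℂ) : ℕ → l2 (Memory × Memory) :=
  wordVector α (fun i => l2PushFst Memory (supplyDigit i))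
    (fun j => l2PushSnd Memory (supplyDigit j)) (lp.single 2 0 1)

theorem eq_zero_of_copies_apply_ne_zero {α : Fin d → Fin d → ℂ} {k : ℕ} {x : Memory × Memory}
    (hx : copies α k x ≠ 0) : x.1.1 = 0 ∧ x.2.1 = 0 ∧ x.1.2.1 = k := by
  induction k generalizing x with
  | zero =>
    have hx0 : x = 0 := by
      by_contra h
      exact hx (by simp [copies, wordVector, h])
    simp [hx0]
  | succ k ih =>
    have hx' : ∑ i, ∑ j, α i j • l2PushFst Memory (supplyDigit i)
        (l2PushSnd Memory (supplyDigit j) (copies α k)) x ≠ 0 := by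
      simp only [copies, wordVector, lp.coeFn_sum, Finset.sum_apply, lp.coeFn_smul,
        Pi.smul_apply] at hx
      exact hx
    obtain ⟨i, -, hi⟩ := Finset.exists_ne_zero_of_sum_ne_zero hx'
    obtain ⟨j, -, hj⟩ := Finset.exists_ne_zero_of_sum_ne_zero hi
    obtain ⟨y, rfl, hy⟩ := exists_of_l2Push_apply_ne_zero (right_ne_zero_of_smul hj)
    obtain ⟨z, rfl, hz⟩ := exists_of_l2Push_apply_ne_zero hy
    obtain ⟨h1, h2, h3⟩ := ih hz
    refine ⟨h1, h2, ?_⟩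
    change z.1.2.1 + 1 = _
    rw [h3]
    simp

theorem orthonormal_copies (hd : 1 ≤ d) {α : Fin d → Fin d → ℂ}
    (hα : ∑ i, ∑ j, ‖α i j‖ ^ 2 = 1) : Orthonormal ℂ (copies α) := by
  refine ⟨norm_wordVector hα (isCuntzFamily_l2PushFst (bijective_supplyDigit hd))
    (isCuntzFamily_l2PushSnd (bijective_supplyDigit hd))
    (starCommuting_l2PushFst_l2PushSnd _ _) (by simp [lp.norm_single]), fun k l hkl => ?_⟩
  change ⟪copies α k, copies α l⟫_ℂ = 0
  rw [lp.inner_eq_tsum]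
  refine (tsum_congr fun x => ?_).trans tsum_zero
  by_cases hk : copies α k x = 0
  · rw [hk, inner_zero_left]
  by_cases hl : copies α l x = 0
  · rw [hl, inner_zero_right]
  have h := (eq_zero_of_copies_apply_ne_zero hk).2.2.symm.trans
    (eq_zero_of_copies_apply_ne_zero hl).2.2
  exact absurd (by exact_mod_cast h) hkl

end Registers
end

section
open Filter Topology

theorem isUnitaryOpMatrix_of_isCuntzFamily {H : Type*} [NormedAddCommGroup H]
    [InnerProductSpace ℂ H] [CompleteSpace H] {d : ℕ} {s s' : Fin d → (H →L[ℂ] H)}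
    (hs : IsCuntzFamily s) (hs' : IsCuntzFamily s') :
    IsUnitaryOpMatrix fun i j => s' j * star (s i) :=
  ⟨hs.sum_star_mul_mul_star hs', hs.sum_mul_star_mul_star hs'⟩

theorem starCommuteFamilies_of_starCommuting {H : Type*} [NormedAddCommGroup H]
    [InnerProductSpace ℂ H] [CompleteSpace H] {d : ℕ} {s s' t t' : Fin d → (H →L[ℂ] H)}
    (hst : StarCommuting s t) (hst' : StarCommuting s t') (hs't : StarCommuting s' t)
    (hs't' : StarCommuting s' t') :
    StarCommuteFamilies (fun i j => s' j * star (s i)) (fun i j => t' j * star (t i)) := by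
  refine fun i j k l => ⟨?_, ?_⟩
  · exact ((hs't' j l).1.mul_right (hs't.commute_star_right j k)).mul_left
      ((hst' i l).2.mul_right (hst.commute_star_star i k))
  · have h : Commute (star (s' j * star (s i))) (t' l * star (t k)) := by
      rw [star_mul, star_star]
      exact ((hst' i l).1.mul_right (hst.commute_star_right i k)).mul_left
        ((hs't' j l).2.mul_right (hs't.commute_star_star j k))
    exact h

theorem IsCuntzFamily.map {ι A B : Type*} [Fintype ι] [DecidableEq ι] [Ring A] [StarRing A]
    [Algebra ℂ A] [Ring B] [StarRing B] [Algebra ℂ B] {s : ι → A} (hs : IsCuntzFamily s)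
    (π : A →⋆ₐ[ℂ] B) : IsCuntzFamily fun i => π (s i) where
  star_mul_eq_ite i j := by
    rw [← map_star, ← map_mul, hs.star_mul_eq_ite]
    split_ifs <;> simp
  sum_mul_star := by
    have h := congrArg π hs.sum_mul_star
    rw [map_sum, map_one] at h
    refine (Finset.sum_congr rfl fun i _ => ?_).trans h
    rw [map_mul, map_star]

theorem StarCommuting.map {ι κ A B : Type*} [Ring A] [StarRing A]
    [Algebra ℂ A] [Ring B] [StarRing B] [Algebra ℂ B] {s : ι → A} {t : κ → A}
    (h : StarCommuting s t) (π : A →⋆ₐ[ℂ] B) :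
    StarCommuting (fun i => π (s i)) (fun j => π (t j)) := fun i j =>
  ⟨(h i j).1.map π, by rw [← map_star]; exact (h i j).2.map π⟩

theorem IsCuntzFamily.codRestrict {ι A : Type*} [Fintype ι] [DecidableEq ι] [Ring A] [StarRing A]
    [Algebra ℂ A] [StarModule ℂ A] {B : StarSubalgebra ℂ A} {s : ι → A} (hs : IsCuntzFamily s)
    (hB : ∀ i, s i ∈ B) : IsCuntzFamily fun i => (⟨s i, hB i⟩ : B) where
  star_mul_eq_ite i j := by
    apply Subtype.ext
    refine (hs.star_mul_eq_ite i j).trans ?_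
    split_ifs <;> rfl
  sum_mul_star := by
    apply Subtype.ext
    simpa using hs.sum_mul_star

theorem StarCommuting.codRestrict {ι κ A : Type*} [Ring A] [StarRing A]
    [Algebra ℂ A] [StarModule ℂ A] {B : StarSubalgebra ℂ A} {s : ι → A} {t : κ → A}
    (h : StarCommuting s t) (hs : ∀ i, s i ∈ B) (ht : ∀ j, t j ∈ B) :
    StarCommuting (fun i => (⟨s i, hs i⟩ : B)) (fun j => (⟨t j, ht j⟩ : B)) := fun i j =>
  ⟨Subtype.ext (h i j).1, Subtype.ext (h i j).2⟩

/-- Operators which embezzle along an orthonormal sequence yield, in the limit, operators which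
embezzle perfectly. -/
theorem exists_perfect_embezzlement_of_orthonormal {K : Type*} [NormedAddCommGroup K]
    [InnerProductSpace ℂ K] [CompleteSpace K] {d : ℕ} (o : Fin d) {α : Fin d → Fin d → ℂ}
    {s s' t t' : Fin d → (K →L[ℂ] K)} {r : K →L[ℂ] K} (hs : IsCuntzFamily s)
    (hs' : IsCuntzFamily s') (ht : IsCuntzFamily t) (ht' : IsCuntzFamily t')
    (hst : StarCommuting s t) (hst' : StarCommuting s t') (hs't : StarCommuting s' t)
    (hs't' : StarCommuting s' t') (hr : star r * r = 1) {ξ : ℕ → K} (hξ : Orthonormal ℂ ξ)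
    (hs'ξ : ∀ k, s' o (ξ k) = ξ k) (ht'ξ : ∀ k, t' o (ξ k) = ξ k) (hrξ : ∀ k, star r (ξ k) = 0)
    (hξ_succ : ∀ i j k, star (s i) (star (t j) (ξ (k + 1))) = α i j • ξ k) :
    ∃ (ψ : l2 ℕ) (U V : Fin d → Fin d → (l2 ℕ →L[ℂ] l2 ℕ)),
      ‖ψ‖ = 1 ∧ IsUnitaryOpMatrix U ∧ IsUnitaryOpMatrix V ∧ StarCommuteFamilies U V ∧
      ∀ i j, U i o (V j o ψ) = α i j • ψ := by
  have hshift : ∀ i j k, (s' o * star (s i) * (t' o * star (t j))) (ξ (k + 1))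
      = α i j • ξ k := fun i j k => by
    rw [mul_assoc, ← mul_assoc (star (s i)), (hst' i o).2.eq]
    simp only [mul_apply_eq_comp]
    rw [hξ_succ, map_smul, map_smul, ht'ξ, hs'ξ]
  obtain ⟨B, hB, π, Ω, hΩ, hlim⟩ := exists_limit_representation _ hξ.norm_normalized_sum
    (s := Set.range s ∪ Set.range s' ∪ (Set.range t ∪ Set.range t') ∪ {r})
    ((((Set.countable_range _).union (Set.countable_range _)).union
      ((Set.countable_range _).union (Set.countable_range _))).union (Set.countable_singleton r))
    (r := r) (by simp) hr
    fun n => by simp only [map_smul, map_sum, hrξ, Finset.sum_const_zero, smul_zero]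
  have hsB : ∀ i, s i ∈ B := fun i => hB (by simp)
  have hs'B : ∀ i, s' i ∈ B := fun i => hB (by simp)
  have htB : ∀ i, t i ∈ B := fun i => hB (by simp)
  have ht'B : ∀ i, t' i ∈ B := fun i => hB (by simp)
  refine ⟨Ω, _, _, hΩ,
    isUnitaryOpMatrix_of_isCuntzFamily ((hs.codRestrict hsB).map π) ((hs'.codRestrict hs'B).map π),
    isUnitaryOpMatrix_of_isCuntzFamily ((ht.codRestrict htB).map π) ((ht'.codRestrict ht'B).map π),
    starCommuteFamilies_of_starCommuting ((hst.codRestrict hsB htB).map π)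
      ((hst'.codRestrict hsB ht'B).map π) ((hs't.codRestrict hs'B htB).map π)
      ((hs't'.codRestrict hs'B ht'B).map π), fun i j => ?_⟩
  have h := hlim (⟨s' o, hs'B _⟩ * star ⟨s i, hsB i⟩ *
    (⟨t' o, ht'B _⟩ * star ⟨t j, htB j⟩) - α i j • 1)
    (tendsto_norm_apply_normalized_sum hξ.1 (hshift i j))
  rw [map_sub, map_mul, map_mul, map_mul, map_smul, map_one, map_star, map_star, sub_apply,
    smul_apply, one_apply_eq_self, sub_eq_zero] at h
  exact h

end

/-- Every entangled state `∑ α_{ij} |i⟩⊗|j⟩` of two `d`-level systems can be perfectly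
embezzled in the commuting operator framework. -/
theorem perfect_embezzlement_general_state (d : ℕ) (hd : 1 ≤ d)
    (α : Fin d → Fin d → ℂ) (hα : ∑ i, ∑ j, ‖α i j‖ ^ 2 = 1) :
    ∃ (ψ : l2 ℕ) (U V : Fin d → Fin d → (l2 ℕ →L[ℂ] l2 ℕ)),
      ‖ψ‖ = 1 ∧
      IsUnitaryOpMatrix U ∧ IsUnitaryOpMatrix V ∧
      StarCommuteFamilies U V ∧
      ∀ i j, U i ⟨0, hd⟩ (V j ⟨0, hd⟩ ψ) = (α i j) • ψ := by
  have hs : IsCuntzFamily fun i : Fin d => l2PushFst Memory (supplyDigit i) :=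
    isCuntzFamily_l2PushFst (bijective_supplyDigit hd)
  have ht : IsCuntzFamily fun i : Fin d => l2PushSnd Memory (supplyDigit i) :=
    isCuntzFamily_l2PushSnd (bijective_supplyDigit hd)
  refine exists_perfect_embezzlement_of_orthonormal ⟨0, hd⟩ (r := l2PushFst Memory shiftStore) hs
    (isCuntzFamily_l2PushFst (bijective_storeDigit hd)) ht
    (isCuntzFamily_l2PushSnd (bijective_storeDigit hd))
    (starCommuting_l2PushFst_l2PushSnd _ _) (starCommuting_l2PushFst_l2PushSnd _ _)
    (starCommuting_l2PushFst_l2PushSnd _ _) (starCommuting_l2PushFst_l2PushSnd _ _)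
    ((congrArg (· * l2PushFst Memory shiftStore) (star_l2Push _)).trans (l2Comp_mul_l2Push_self _))
    (orthonormal_copies hd hα) (fun k => l2Push_eq_self fun x hx => ?_)
    (fun k => l2Push_eq_self fun x hx => ?_) (fun k => ?_)
    (star_apply_star_apply_wordVector_succ hs ht (starCommuting_l2PushFst_l2PushSnd _ _))
  · have h := (eq_zero_of_copies_apply_ne_zero hx).1
    refine Prod.ext (Prod.ext ?_ rfl) rfl
    change d * x.1.1 + 0 = x.1.1
    rw [h, mul_zero]
  · have h := (eq_zero_of_copies_apply_ne_zero hx).2.1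
    refine Prod.ext rfl (Prod.ext ?_ rfl)
    change d * x.2.1 + 0 = x.2.1
    rw [h, mul_zero]
  · refine star_l2Push_apply_eq_zero fun x => ?_
    by_contra hx
    exact Nat.succ_ne_zero _ (eq_zero_of_copies_apply_ne_zero hx).1
end

section
/- There is a perfect strategy for the coherent embezzlement game in the commuting operator framework: writing R := ℓ²(ℕ), there exist a unit vector ψ ∈ R and families P, Q : Fin 2 → Matrix (Fin 3) (Fin 3) (R →L[ℂ] R) such that: (1) each P a and each Q b is a projection in the *-ring of 3×3 operator matrices (star (P a) = P a and (P a) * (P a) = P a, and likewise for Q b), with P 0 + P 1 = 1 and Q 0 + Q 1 = 1; (2) every entry (P a) i j *-commutes with every entry (Q b) k l; and (3) for all c, a, b ∈ Fin 2 with a + b ≠ c (mod 2) and all i, k ∈ Fin 3: ∑ j, ∑ l, (P a) i j ((Q b) k l ((α c j l) • ψ)) = 0. (Condition (3) says that on input state φ_c, the probability that Alice's outcome a and Bob's outcome b satisfy a ⊕ b ≠ c is zero.) -/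
/-- The coefficients of the two input states `φ_c` of the Regev–Vidick coherent
embezzlement game: `α c 0 0 = 1/√2`, `α c 1 1 = α c 2 2 = (-1)^c / 2`, and `0` otherwise. -/
noncomputable def gameCoeff (c : Fin 2) (i j : Fin 3) : ℂ :=
  if i = 0 ∧ j = 0 then 1 / Real.sqrt 2
  else if i = j then (-1) ^ (c : ℕ) / 2
  else 0

section weightedComp

variable {X Y : Type*} {c : X → ℂ} {σ : X → Y}

theorem norm_mul_comp_rpow_le (hc : ∀ x, ‖c x‖ ≤ 1) (f : l2 Y) (x : X) :
    ‖c x * f (σ x)‖ ^ (2 : ENNReal).toReal ≤ ‖f (σ x)‖ ^ (2 : ENNReal).toReal := by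
  gcongr
  rw [norm_mul]
  exact mul_le_of_le_one_left (norm_nonneg _) (hc x)

theorem summable_norm_comp_rpow (hσ : σ.Injective) (f : l2 Y) :
    Summable fun x => ‖f (σ x)‖ ^ (2 : ENNReal).toReal :=
  ((lp.memℓp f).summable (by norm_num)).comp_injective hσ

theorem summable_norm_mul_comp_rpow (hc : ∀ x, ‖c x‖ ≤ 1) (hσ : σ.Injective) (f : l2 Y) :
    Summable fun x => ‖c x * f (σ x)‖ ^ (2 : ENNReal).toReal :=
  (summable_norm_comp_rpow hσ f).of_nonneg_of_le (fun _ => by positivity)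
    (norm_mul_comp_rpow_le hc f)

theorem norm_mul_comp_le (hc : ∀ x, ‖c x‖ ≤ 1) (hσ : σ.Injective) (f : l2 Y) :
    ‖(⟨fun x => c x * f (σ x), memℓp_gen (summable_norm_mul_comp_rpow hc hσ f)⟩ : l2 X)‖ ≤
      ‖f‖ := by
  refine lp.norm_le_of_tsum_le (by norm_num) (norm_nonneg _) ?_
  rw [lp.norm_rpow_eq_tsum (by norm_num)]
  refine ((summable_norm_mul_comp_rpow hc hσ f).tsum_le_tsum (norm_mul_comp_rpow_le hc f)
    (summable_norm_comp_rpow hσ f)).trans ?_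
  exact tsum_comp_le_tsum_of_inj ((lp.memℓp f).summable (by norm_num))
    (fun _ => by positivity) hσ

/-- Multiplication by the bounded weight `c` composed with precomposition by the injection `σ`,
as a bounded operator between `ℓ²` spaces. -/
noncomputable def weightedComp {X Y : Type*} (c : X → ℂ) (hc : ∀ x, ‖c x‖ ≤ 1) (σ : X → Y)
    (hσ : σ.Injective) : l2 Y →L[ℂ] l2 X :=
  LinearMap.mkContinuous
    { toFun := fun f =>
        ⟨fun x => c x * f (σ x), memℓp_gen (summable_norm_mul_comp_rpow hc hσ f)⟩
      map_add' := fun f g => by ext x; exact mul_add _ _ _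
      map_smul' := fun r f => by ext x; simp [mul_left_comm] }
    1 fun f => (norm_mul_comp_le hc hσ f).trans_eq (one_mul _).symm

variable (hc : ∀ x, ‖c x‖ ≤ 1) (hσ : σ.Injective)

@[simp]
theorem weightedComp_apply (f : l2 Y) (x : X) :
    weightedComp c hc σ hσ f x = c x * f (σ x) := rfl

theorem norm_weightedComp_apply_le (f : l2 Y) : ‖weightedComp c hc σ hσ f‖ ≤ ‖f‖ :=
  norm_mul_comp_le hc hσ f

theorem adjoint_apply_eq_inner [DecidableEq Y] (T : l2 Y →L[ℂ] l2 X) (f : l2 X)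
    (y : Y) :
    ContinuousLinearMap.adjoint T f y = inner ℂ (T (lp.single 2 y 1)) f := by
  rw [← ContinuousLinearMap.adjoint_inner_right, lp.inner_single_left]
  simp

theorem adjoint_weightedComp_apply (f : l2 X) (x : X) :
    ContinuousLinearMap.adjoint (weightedComp c hc σ hσ) f (σ x) = star (c x) * f x := by
  classical
  have : weightedComp c hc σ hσ (lp.single 2 (σ x) 1) = lp.single 2 x (c x) := by
    ext y
    rcases eq_or_ne y x with rfl | h
    · simp
    · simp [h, hσ.ne h]
  rw [adjoint_apply_eq_inner, this, lp.inner_single_left]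
  simp [mul_comm]

theorem adjoint_weightedComp_apply_of_notMem_range (f : l2 X) {y : Y} (hy : y ∉ Set.range σ) :
    ContinuousLinearMap.adjoint (weightedComp c hc σ hσ) f y = 0 := by
  classical
  have : weightedComp c hc σ hσ (lp.single 2 y 1) = 0 := by
    ext x
    have : σ x ≠ y := fun h => hy ⟨x, h⟩
    simp [this]
  rw [adjoint_apply_eq_inner, this, inner_zero_left]

end weightedComp

/-- The unitary between `ℓ²` spaces induced by a bijection of the index types. -/
noncomputable def l2Congr {X Y : Type*} (e : X ≃ Y) : l2 X ≃ₗᵢ[ℂ] l2 Y where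
  toLinearEquiv := LinearEquiv.ofLinearMap
    (weightedComp (fun _ => 1) (by simp) e.symm e.symm.injective).toLinearMap
    (weightedComp (fun _ => 1) (by simp) e e.injective).toLinearMap
    (by ext f y; simp) (by ext f x; simp)
  norm_map' f := by
    refine le_antisymm (norm_weightedComp_apply_le (by simp) e.symm.injective f) ?_
    have h := norm_weightedComp_apply_le (c := fun _ => 1) (by simp) e.injective
      (weightedComp (fun _ => 1) (by simp) e.symm e.symm.injective f)
    have h_eq : weightedComp (fun _ => 1) (by simp) e e.injective
        (weightedComp (fun _ => 1) (by simp) e.symm e.symm.injective f) = f := by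
      ext x
      simp
    rw [h_eq] at h
    exact h

/-- A pair of operators `v false, v true` whose adjoints satisfy the Cuntz relations of `𝒪₂`. -/
structure IsCoCuntz {R : Type*} [Ring R] [StarRing R] (v : Bool → R) : Prop where
  mul_star (a b : Bool) : v a * star (v b) = if a = b then 1 else 0
  sum_star_mul : ∑ a, star (v a) * v a = 1

namespace IsCoCuntz

variable {R : Type*} [Ring R] [StarRing R] {v : Bool → R}

theorem map {S : Type*} [Ring S] [StarRing S] [Algebra ℂ R] [Algebra ℂ S] (hv : IsCoCuntz v)
    (φ : R ≃⋆ₐ[ℂ] S) : IsCoCuntz fun a => φ (v a) where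
  mul_star a b := by
    rw [← map_star, ← map_mul, hv.mul_star]
    split_ifs <;> simp
  sum_star_mul := by
    simp only [← map_star, ← map_mul, ← map_sum, hv.sum_star_mul, map_one]

theorem star_commute (hv : IsCoCuntz v) {x : R} (hx : ∀ a, Commute (v a) x) (a : Bool) :
    Commute (star (v a)) x := by
  have h (b : Bool) : v b * x * star (v a) = if b = a then x else 0 := by
    rw [(hx b).eq, mul_assoc, hv.mul_star]
    split_ifs <;> simp
  calc star (v a) * x = ∑ b, star (v b) * (v b * x * star (v a)) := by
        simp only [h]; simp
    _ = (∑ b, star (v b) * v b) * (x * star (v a)) := by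
        simp only [Finset.sum_mul, mul_assoc]
    _ = x * star (v a) := by rw [hv.sum_star_mul, one_mul]

end IsCoCuntz

section flip

variable {R : Type*} [Ring R] [StarRing R]

/-- The operator on `ℂ³ ⊗ R` exchanging `|0⟩ ⊗ R` with its image under the column `v`. -/
def flipMatrix (v : Bool → R) : Matrix (Fin 3) (Fin 3) R :=
  !![0, star (v false), star (v true); v false, 0, 0; v true, 0, 0]

theorem star_flipMatrix (v : Bool → R) : star (flipMatrix v) = flipMatrix v := by
  ext i j
  fin_cases i <;> fin_cases j <;> simp [flipMatrix]

theorem IsCoCuntz.flipMatrix_mul_self {v : Bool → R} (hv : IsCoCuntz v) :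
    flipMatrix v * flipMatrix v = 1 := by
  have h := hv.sum_star_mul
  rw [Fintype.sum_bool, add_comm] at h
  ext i j
  fin_cases i <;> fin_cases j <;> simp [flipMatrix, Matrix.mul_apply, Fin.sum_univ_three,
    hv.mul_star, h]

theorem commute_flipMatrix_left {v : Bool → R} {x : R} (h : ∀ a, Commute (v a) x)
    (h' : ∀ a, Commute (star (v a)) x) (i j : Fin 3) : Commute (flipMatrix v i j) x := by
  fin_cases i <;> fin_cases j <;> simp [flipMatrix, h, h']

theorem IsCoCuntz.commute_flipMatrix {v w : Bool → R} (hv : IsCoCuntz v) (hw : IsCoCuntz w)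
    (h : ∀ a b, Commute (v a) (w b)) (i j k l : Fin 3) :
    Commute (flipMatrix v i j) (flipMatrix w k l) := by
  refine (commute_flipMatrix_left (fun b => Commute.symm ?_) (fun b => Commute.symm ?_) k l).symm
  · exact commute_flipMatrix_left (fun a => h a b) (hv.star_commute fun a => h a b) i j
  · exact commute_flipMatrix_left (fun a => (hw.star_commute (fun b => (h a b).symm) b).symm)
      (fun a => (h a b).star_star) i j

variable [Algebra ℂ R]

/-- The spectral projection of `flipMatrix v` for the eigenvalue `(-1) ^ a`. -/
noncomputable def flipProj (v : Bool → R) (a : Fin 2) : Matrix (Fin 3) (Fin 3) R :=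
  (1 / 2 : ℂ) • (1 + (-1 : ℂ) ^ (a : ℕ) • flipMatrix v)

theorem flipProj_zero_add_one (v : Bool → R) : flipProj v 0 + flipProj v 1 = 1 := by
  simp only [flipProj]
  norm_num
  module

theorem IsCoCuntz.flipProj_mul_self {v : Bool → R} (hv : IsCoCuntz v) (a : Fin 2) :
    flipProj v a * flipProj v a = flipProj v a := by
  have h := hv.flipMatrix_mul_self
  fin_cases a <;> simp [flipProj, mul_add, add_mul, h] <;> module

theorem star_flipProj [StarModule ℂ R] (v : Bool → R) (a : Fin 2) :
    star (flipProj v a) = flipProj v a := by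
  fin_cases a <;> simp [flipProj, star_flipMatrix, star_smul]

theorem IsCoCuntz.commute_flipProj {v w : Bool → R} (hv : IsCoCuntz v) (hw : IsCoCuntz w)
    (h : ∀ a b, Commute (v a) (w b)) (a b : Fin 2) (i j k l : Fin 3) :
    Commute (flipProj v a i j) (flipProj w b k l) := by
  have hone (x : R) (i j : Fin 3) : Commute ((1 : Matrix (Fin 3) (Fin 3) R) i j) x := by
    rw [Matrix.one_apply]
    split_ifs <;> simp
  have := hv.commute_flipMatrix hw h i j k l
  simp only [flipProj, Matrix.smul_apply, Matrix.add_apply]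
  refine Commute.smul_left (Commute.smul_right ?_ _) _
  exact ((hone _ i j).add_left ((((hone _ k l).symm).add_right (this.smul_right _)).smul_left _))

end flip

section vectors

variable {H : Type*} [NormedAddCommGroup H] [InnerProductSpace ℂ H] {v w : Bool → H →L[ℂ] H} {ψ : H}

theorem apply_apply_comm (h : ∀ a b, Commute (v a) (w b))
    (hψ : ∀ a b, v a (w b ψ) = if a = b then (1 / Real.sqrt 2 : ℂ) • ψ else 0) (a b : Bool) :
    w a (v b ψ) = if a = b then (1 / Real.sqrt 2 : ℂ) • ψ else 0 := by
  simp only [eq_comm (a := a), ← hψ]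
  exact congr($((h b a).eq.symm) ψ)

variable [CompleteSpace H]

theorem IsCoCuntz.apply_star_apply (hv : IsCoCuntz v) (a b : Bool) (x : H) :
    v a (star (v b) x) = if a = b then x else 0 := by
  have := congr($(hv.mul_star a b) x)
  split_ifs at this ⊢ <;> simpa using this

theorem IsCoCuntz.sum_star_apply_apply (hv : IsCoCuntz v) (x : H) :
    star (v false) (v false x) + star (v true) (v true x) = x := by
  simpa [add_comm] using congr($(hv.sum_star_mul) x)

theorem inv_sqrt_two_mul_self : (1 / Real.sqrt 2 : ℂ) * (1 / Real.sqrt 2) = 1 / 2 := by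
  rw [div_mul_div_comm, ← Complex.ofReal_mul, Real.mul_self_sqrt (by norm_num)]
  norm_num

/-- If commuting co-Cuntz pairs extract a maximally entangled qubit pair from `ψ`, then the action
of one pair on `ψ` is determined by the adjoint of the other. -/
theorem IsCoCuntz.apply_eq_smul_star_apply (hv : IsCoCuntz v)
    (hψ : ∀ a b, v a (w b ψ) = if a = b then (1 / Real.sqrt 2 : ℂ) • ψ else 0) (a : Bool) :
    w a ψ = (1 / Real.sqrt 2 : ℂ) • star (v a) ψ := by
  rw [← hv.sum_star_apply_apply (w a ψ), hψ, hψ]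
  cases a <;> simp

/-- The coefficients `gameCoeff` are supported on the diagonal. -/
theorem gameCoeff_eq (c : Fin 2) (i j : Fin 3) :
    gameCoeff c i j = if i = j then gameCoeff c i i else 0 := by
  unfold gameCoeff
  grind

theorem flipMatrix_apply_gameCoeff_smul (hv : IsCoCuntz v) (hw : IsCoCuntz w)
    (h : ∀ a b, Commute (v a) (w b))
    (hψ : ∀ a b, v a (w b ψ) = if a = b then (1 / Real.sqrt 2 : ℂ) • ψ else 0)
    (c : Fin 2) (i k : Fin 3) :
    flipMatrix w k i (gameCoeff c i i • ψ) =
      (-1 : ℂ) ^ (c : ℕ) • flipMatrix v i k (gameCoeff c k k • ψ) := by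
  have hs := inv_sqrt_two_mul_self
  have hwψ := hv.apply_eq_smul_star_apply hψ
  have hvψ := hw.apply_eq_smul_star_apply (apply_apply_comm h hψ)
  have hc : (-1 : ℂ) ^ (c : ℕ) * (-1) ^ (c : ℕ) = 1 := by rw [← mul_pow]; simp
  generalize hz : (-1 : ℂ) ^ (c : ℕ) = z at hc
  generalize hr : (1 / Real.sqrt 2 : ℂ) = s at hs hwψ hvψ
  have h0 : gameCoeff c 0 0 = s := by simp [gameCoeff, ← hr]
  have h1 : gameCoeff c 1 1 = z / 2 := by simp [gameCoeff, ← hz]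
  have h2 : gameCoeff c 2 2 = z / 2 := by simp [gameCoeff, ← hz]
  have e1 : z * (z / 2) = s * s := by linear_combination hc / 2 - hs
  have e2 : z * (s * s) = z / 2 := by linear_combination z * hs
  fin_cases i <;> fin_cases k <;>
    simp [flipMatrix, h0, h1, h2, hwψ, hvψ, smul_smul, e1, e2]

theorem sum_flipMatrix_flipMatrix_apply (hv : IsCoCuntz v) (hw : IsCoCuntz w)
    (h : ∀ a b, Commute (v a) (w b))
    (hψ : ∀ a b, v a (w b ψ) = if a = b then (1 / Real.sqrt 2 : ℂ) • ψ else 0)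
    (c : Fin 2) (i k : Fin 3) :
    ∑ j, flipMatrix v i j (flipMatrix w k j (gameCoeff c j j • ψ)) =
      (-1 : ℂ) ^ (c : ℕ) • (if i = k then gameCoeff c i i • ψ else 0) := by
  have key := congr($(hv.flipMatrix_mul_self) i k (gameCoeff c k k • ψ))
  simp only [flipMatrix_apply_gameCoeff_smul hv hw h hψ, map_smul]
  rw [← Finset.smul_sum]
  simp only [Matrix.mul_apply, sum_apply, mul_apply_eq_comp] at key
  congr 1
  simp only [Matrix.one_apply] at key
  split_ifs at key ⊢ with hik
  · subst hik; simpa using key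
  · simpa using key

/-- Commuting co-Cuntz pairs that extract a maximally entangled qubit pair from `ψ` without
changing `ψ` yield a perfect strategy. -/
theorem sum_flipProj_flipProj_apply_eq_zero (hv : IsCoCuntz v) (hw : IsCoCuntz w)
    (h : ∀ a b, Commute (v a) (w b))
    (hψ : ∀ a b, v a (w b ψ) = if a = b then (1 / Real.sqrt 2 : ℂ) • ψ else 0)
    {c a b : Fin 2} (habc : a + b ≠ c) (i k : Fin 3) :
    ∑ j, ∑ l, (flipProj v a) i j ((flipProj w b) k l ((gameCoeff c j l) • ψ)) = 0 := by
  have hsum (j : Fin 3) :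
      ∑ l, (flipProj v a) i j ((flipProj w b) k l ((gameCoeff c j l) • ψ)) =
        (flipProj v a) i j ((flipProj w b) k j ((gameCoeff c j j) • ψ)) := by
    rw [Finset.sum_eq_single j (fun l _ hl => by rw [gameCoeff_eq, if_neg hl.symm]; simp) (by simp)]
  have happ (u : Bool → H →L[ℂ] H) (a : Fin 2) (i j : Fin 3) (x : H) : flipProj u a i j x =
      (1 / 2 : ℂ) • ((if i = j then x else 0) + (-1 : ℂ) ^ (a : ℕ) • flipMatrix u i j x) := by
    simp only [flipProj, Matrix.smul_apply, Matrix.add_apply, Matrix.one_apply]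
    split_ifs <;> simp
  have h₁ := sum_flipMatrix_flipMatrix_apply hv hw h hψ c i k
  have h₂ := flipMatrix_apply_gameCoeff_smul hv hw h hψ c i k
  have hexp : ∑ j, (flipProj v a) i j ((flipProj w b) k j ((gameCoeff c j j) • ψ)) =
      (1 / 4 : ℂ) • ((if i = k then gameCoeff c i i • ψ else 0)
        + (-1 : ℂ) ^ (b : ℕ) • flipMatrix w k i (gameCoeff c i i • ψ)
        + (-1 : ℂ) ^ (a : ℕ) • flipMatrix v i k (gameCoeff c k k • ψ)
        + ((-1 : ℂ) ^ (a : ℕ) * (-1 : ℂ) ^ (b : ℕ)) •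
          ∑ j, flipMatrix v i j (flipMatrix w k j (gameCoeff c j j • ψ))) := by
    have (j : Fin 3) : flipMatrix v i j (if k = j then gameCoeff c j j • ψ else 0) =
        if k = j then flipMatrix v i j (gameCoeff c j j • ψ) else 0 := by split_ifs <;> simp
    simp only [happ, map_smul, map_add, this, smul_add, Finset.sum_add_distrib, ← Finset.smul_sum,
      Finset.sum_ite_eq, Finset.mem_univ, if_true]
    simp only [eq_comm (a := k) (b := i)]
    module
  simp only [hsum]
  rw [hexp, h₁, h₂]
  have hsign : (-1 : ℂ) ^ (a : ℕ) * (-1) ^ (b : ℕ) * (-1) ^ (c : ℕ) = -1 ∧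
      (-1 : ℂ) ^ (b : ℕ) * (-1) ^ (c : ℕ) = - (-1) ^ (a : ℕ) := by
    fin_cases a <;> fin_cases b <;> fin_cases c <;> simp at habc ⊢
  simp only [smul_smul, hsign]
  module

end vectors

/-- Labels of an orthonormal basis of the resource space. The label `(none, n)` stands for a
sector in which the qubits of both parties are paired up, the base-4 digits of `n` describing the
state of each pair; `(some (p, c, l), n)` stands for a sector in which party `p` holds the extra
qubits `c :: l` besides the pairs described by `n`. -/
abbrev QubitLabel := Option (Bool × Bool × List Bool) × ℕ

namespace QubitLabel

/-- Push a qubit pair onto `n`, with bits `a` of party `p` and `c` of party `!p`. -/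
def pushPair (p a c : Bool) (n : ℕ) : ℕ :=
  4 * n + if p then 2 * a.toNat + c.toNat else 2 * c.toNat + a.toNat

/-- Party `p` appends a qubit in the state `a`, which is paired up with the first extra qubit of the
other party if there is one. -/
def insert (p a : Bool) : QubitLabel → QubitLabel
  | (none, n) => (some (p, a, []), n)
  | (some (q, c, l), n) =>
    if q = p then (some (q, c, l ++ [a]), n)
    else match l with
      | [] => (none, pushPair p a c n)
      | d :: l => (some (q, d, l), pushPair p a c n)

/-- Exchange the states `00` and `11` of the first pair. -/
def flipPair (n : ℕ) : ℕ :=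
  if n % 4 = 0 then n + 3 else if n % 4 = 3 then n - 3 else n

/-- Whether party `p` has no extra qubits. -/
def isPaired (p : Bool) : QubitLabel → Bool
  | (none, _) => true
  | (some (q, _, _), _) => q != p

/-- The diagonal coefficient of the change of basis. -/
noncomputable def diagCoeff (n : ℕ) : ℂ :=
  if n % 4 = 0 then 1 / Real.sqrt 2 else if n % 4 = 3 then - (1 / Real.sqrt 2) else 1

/-- The off-diagonal coefficient of the change of basis. -/
noncomputable def offDiagCoeff (n : ℕ) : ℂ :=
  if n % 4 = 0 ∨ n % 4 = 3 then 1 / Real.sqrt 2 else 0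

theorem flipPair_flipPair (n : ℕ) : flipPair (flipPair n) = n := by
  unfold flipPair
  split_ifs <;> omega

theorem offDiagCoeff_flipPair (n : ℕ) : offDiagCoeff (flipPair n) = offDiagCoeff n := by
  unfold offDiagCoeff flipPair
  congr 1
  grind

theorem diagCoeff_sq_add_offDiagCoeff_sq (n : ℕ) :
    diagCoeff n * diagCoeff n + offDiagCoeff n * offDiagCoeff n = 1 := by
  have := inv_sqrt_two_mul_self
  unfold diagCoeff offDiagCoeff
  grind

theorem offDiagCoeff_mul_diagCoeff_flipPair (n : ℕ) :
    offDiagCoeff n * diagCoeff (flipPair n) = - (offDiagCoeff n * diagCoeff n) := by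
  have h0 : n % 4 = 0 → (n + 3) % 4 = 3 := by omega
  have h3 : n % 4 = 3 → (n - 3) % 4 = 0 := by omega
  unfold diagCoeff offDiagCoeff flipPair
  split_ifs <;> simp_all

theorem norm_inv_sqrt_two_le : ‖(1 / Real.sqrt 2 : ℂ)‖ ≤ 1 := by
  rw [norm_div, Complex.norm_real, norm_one, Real.norm_of_nonneg (Real.sqrt_nonneg 2)]
  exact div_le_one_of_le₀ (Real.one_le_sqrt.2 one_le_two) (Real.sqrt_nonneg 2)

theorem norm_diagCoeff_le (n : ℕ) : ‖diagCoeff n‖ ≤ 1 := by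
  unfold diagCoeff
  split_ifs
  · exact norm_inv_sqrt_two_le
  · rw [norm_neg]; exact norm_inv_sqrt_two_le
  · simp

theorem norm_offDiagCoeff_le (n : ℕ) : ‖offDiagCoeff n‖ ≤ 1 := by
  unfold offDiagCoeff
  split_ifs
  · exact norm_inv_sqrt_two_le
  · simp

theorem star_diagCoeff (n : ℕ) : star (diagCoeff n) = diagCoeff n := by
  unfold diagCoeff
  split_ifs <;> simp

theorem star_offDiagCoeff (n : ℕ) : star (offDiagCoeff n) = offDiagCoeff n := by
  unfold offDiagCoeff
  split_ifs <;> simp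

theorem pushPair_inj {p a b c d : Bool} {m n : ℕ} :
    pushPair p a c m = pushPair p b d n ↔ a = b ∧ c = d ∧ m = n := by
  unfold pushPair
  refine ⟨fun h => ?_, by rintro ⟨rfl, rfl, rfl⟩; rfl⟩
  cases p <;> cases a <;> cases b <;> cases c <;> cases d <;> simp at h ⊢ <;> omega

theorem exists_pushPair (p : Bool) (n : ℕ) : ∃ a c m, pushPair p a c m = n := by
  have h : n % 4 < 4 := Nat.mod_lt _ (by norm_num)
  refine ⟨if p then decide (2 ≤ n % 4) else decide (n % 2 = 1),
    if p then decide (n % 2 = 1) else decide (2 ≤ n % 4), n / 4, ?_⟩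
  unfold pushPair
  cases p <;> by_cases h₁ : 2 ≤ n % 4 <;> by_cases h₂ : n % 2 = 1 <;> simp [h₁, h₂] <;> omega

theorem insert_inj {p a b : Bool} {x y : QubitLabel} :
    insert p a x = insert p b y ↔ a = b ∧ x = y := by
  refine ⟨fun h => ?_, by rintro ⟨rfl, rfl⟩; rfl⟩
  obtain ⟨_ | ⟨q, c, l⟩, m⟩ := x <;> obtain ⟨_ | ⟨q', c', l'⟩, n⟩ := y
  · simpa [insert] using h
  · rcases l' with _ | ⟨d', l'⟩ <;> simp only [insert] at h ⊢ <;> split_ifs at h <;> simp_all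
  · rcases l with _ | ⟨d, l⟩ <;> simp only [insert] at h ⊢ <;> split_ifs at h <;> simp_all
  · cases p <;> cases q <;> cases q' <;> rcases l with _ | ⟨d, l⟩ <;>
      rcases l' with _ | ⟨d', l'⟩ <;> simp [insert, pushPair_inj] at h ⊢ <;> grind

theorem exists_insert (p : Bool) (y : QubitLabel) : ∃ a x, insert p a x = y := by
  obtain ⟨_ | ⟨q, c, l⟩, n⟩ := y
  · obtain ⟨a, c, m, h⟩ := exists_pushPair p n
    exact ⟨a, (some (!p, c, []), m), by simp [insert, h]⟩
  · by_cases hq : q = p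
    · rcases List.eq_nil_or_concat l with rfl | ⟨l, a, rfl⟩
      · exact ⟨c, (none, n), by simp [insert, hq]⟩
      · exact ⟨a, (some (q, c, l), n), by simp [insert, hq]⟩
    · obtain ⟨a, d, m, h⟩ := exists_pushPair p n
      exact ⟨a, (some (q, d, c :: l), m), by simp [insert, h, hq]⟩

/-- The change of basis on the first pair for labels without extra qubits of party `p`, taking
`00` to a maximally entangled state. -/
noncomputable def pairRotation (p : Bool) : l2 QubitLabel →L[ℂ] l2 QubitLabel :=
  weightedComp (fun x => if isPaired p x then diagCoeff x.2 else 1)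
      (fun x => by split_ifs; exacts [norm_diagCoeff_le _, by simp]) id Function.injective_id +
    weightedComp (fun x => if isPaired p x then offDiagCoeff x.2 else 0)
      (fun x => by split_ifs; exacts [norm_offDiagCoeff_le _, by simp])
      (fun x => (x.1, flipPair x.2))
      (Function.Involutive.injective fun x => by simp [flipPair_flipPair])

theorem isPaired_flipPair (p : Bool) (x : QubitLabel) :
    isPaired p (x.1, flipPair x.2) = isPaired p x := by
  obtain ⟨_ | ⟨q, c, l⟩, n⟩ := x <;> rfl

theorem pairRotation_apply (p : Bool) (f : l2 QubitLabel) (x : QubitLabel) :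
    pairRotation p f x = if isPaired p x then
      diagCoeff x.2 * f x + offDiagCoeff x.2 * f (x.1, flipPair x.2) else f x := by
  simp [pairRotation]
  split_ifs <;> simp

theorem star_pairRotation (p : Bool) : star (pairRotation p) = pairRotation p := by
  ext f x
  rw [ContinuousLinearMap.star_eq_adjoint, pairRotation, map_add]
  have h₁ := adjoint_weightedComp_apply (c := fun x => if isPaired p x then diagCoeff x.2 else 1)
    (fun x => by split_ifs; exacts [norm_diagCoeff_le _, by simp]) Function.injective_id f x
  have h₂ := adjoint_weightedComp_apply
    (c := fun x : QubitLabel => if isPaired p x then offDiagCoeff x.2 else 0)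
    (fun x => by split_ifs; exacts [norm_offDiagCoeff_le _, by simp])
    (σ := fun x => (x.1, flipPair x.2))
    (Function.Involutive.injective fun x => by simp [flipPair_flipPair]) f (x.1, flipPair x.2)
  simp only [flipPair_flipPair, isPaired_flipPair, offDiagCoeff_flipPair] at h₂
  simp only [add_apply, lp.coeFn_add, Pi.add_apply, id_eq] at h₁ h₂ ⊢
  rw [h₁, h₂]
  simp only [weightedComp_apply]
  split_ifs <;> simp only [star_diagCoeff, star_offDiagCoeff, star_one, star_zero, id_eq]

theorem pairRotation_mul_self (p : Bool) : pairRotation p * pairRotation p = 1 := by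
  ext f x
  simp only [mul_apply_eq_comp, pairRotation_apply, isPaired_flipPair,
    flipPair_flipPair, offDiagCoeff_flipPair, one_apply_eq_self]
  split_ifs
  · linear_combination f x * diagCoeff_sq_add_offDiagCoeff_sq x.2 +
      f (x.1, flipPair x.2) * offDiagCoeff_mul_diagCoeff_flipPair x.2
  · rfl

/-- Removal of a qubit of party `p` in the label basis. -/
noncomputable def remove (p a : Bool) : l2 QubitLabel →L[ℂ] l2 QubitLabel :=
  weightedComp (fun _ => 1) (by simp) (insert p a) fun _ _ h => (insert_inj.1 h).2

theorem remove_apply (p a : Bool) (f : l2 QubitLabel) (x : QubitLabel) :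
    remove p a f x = f (insert p a x) :=
  one_mul _

theorem star_remove_apply (p a b : Bool) (f : l2 QubitLabel) (x : QubitLabel) :
    star (remove p a) f (insert p b x) = if b = a then f x else 0 := by
  rw [ContinuousLinearMap.star_eq_adjoint]
  split_ifs with h
  · subst h
    exact (adjoint_weightedComp_apply _ _ f x).trans (by rw [star_one, one_mul])
  · refine adjoint_weightedComp_apply_of_notMem_range _ _ f ?_
    rintro ⟨y, hy⟩
    exact h (insert_inj.1 hy).1.symm

theorem isCoCuntz_remove (p : Bool) : IsCoCuntz (remove p) where
  mul_star a b := by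
    ext f x
    simp only [mul_apply_eq_comp, remove_apply, star_remove_apply]
    split_ifs <;> simp
  sum_star_mul := by
    ext f y
    obtain ⟨a, x, rfl⟩ := exists_insert p y
    cases a <;> simp [star_remove_apply, remove_apply]

/-- Extraction of a qubit of party `p` in the state `a`. -/
noncomputable def extract (p a : Bool) : l2 QubitLabel →L[ℂ] l2 QubitLabel :=
  remove p a * pairRotation p

theorem isCoCuntz_extract (p : Bool) : IsCoCuntz (extract p) where
  mul_star a b := by
    rw [extract, extract, star_mul, star_pairRotation, mul_assoc, ← mul_assoc (pairRotation p),
      pairRotation_mul_self, one_mul, (isCoCuntz_remove p).mul_star]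
  sum_star_mul := by
    have (a : Bool) : star (extract p a) * extract p a =
        pairRotation p * (star (remove p a) * remove p a) * pairRotation p := by
      simp only [extract, star_mul, star_pairRotation, mul_assoc]
    simp only [this, ← Finset.sum_mul, ← Finset.mul_sum, (isCoCuntz_remove p).sum_star_mul,
      mul_one, pairRotation_mul_self]

theorem extract_apply (p a : Bool) (f : l2 QubitLabel) (x : QubitLabel) :
    extract p a f x = if isPaired p (insert p a x) then
      diagCoeff (insert p a x).2 * f (insert p a x) +
        offDiagCoeff (insert p a x).2 * f ((insert p a x).1, flipPair (insert p a x).2)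
      else f (insert p a x) := by
  rw [extract, mul_apply_eq_comp, remove_apply, pairRotation_apply]

theorem commute_extract (a b : Bool) : Commute (extract true a) (extract false b) := by
  ext f ⟨_ | ⟨q, c, l⟩, n⟩
  · simp [extract_apply, insert, isPaired, pushPair]
  · cases q <;> rcases l with _ | ⟨d, l⟩ <;>
      simp [extract_apply, insert, isPaired, pushPair]

theorem extract_extract_single (a b : Bool) :
    extract true a (extract false b (lp.single 2 (none, 0) 1)) =
      if a = b then (1 / Real.sqrt 2 : ℂ) • lp.single 2 (none, 0) 1 else 0 := by
  ext ⟨_ | ⟨q, c, l⟩, n⟩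
  · rcases n with _ | n <;> cases a <;> cases b <;>
      simp [extract_apply, insert, isPaired, pushPair, flipPair, diagCoeff, offDiagCoeff,
        lp.single_apply]
  · cases q <;> rcases l with _ | ⟨d, l⟩ <;> cases a <;> cases b <;>
      simp [extract_apply, insert, isPaired, lp.single_apply]

end QubitLabel

/-- There is a perfect strategy for the coherent embezzlement game in the commuting
operator framework. -/
theorem perfect_coherent_embezzlement_commuting :
    ∃ (ψ : l2 ℕ) (P Q : Fin 2 → Matrix (Fin 3) (Fin 3) (l2 ℕ →L[ℂ] l2 ℕ)),
      ‖ψ‖ = 1 ∧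
      -- (1) projective two-outcome measurements for Alice and Bob:
      (∀ a, star (P a) = P a ∧ P a * P a = P a) ∧
      (∀ b, star (Q b) = Q b ∧ Q b * Q b = Q b) ∧
      P 0 + P 1 = 1 ∧ Q 0 + Q 1 = 1 ∧
      -- (2) every entry of Alice's measurements *-commutes with every entry of Bob's:
      (∀ (a b : Fin 2) (i j k l : Fin 3),
        (P a i j) ∘L (Q b k l) = (Q b k l) ∘L (P a i j) ∧
        (ContinuousLinearMap.adjoint (P a i j)) ∘L (Q b k l)
          = (Q b k l) ∘L (ContinuousLinearMap.adjoint (P a i j))) ∧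
      -- (3) on input state `φ_c`, losing outcomes (`a ⊕ b ≠ c`) have probability zero:
      (∀ (c a b : Fin 2), a + b ≠ c → ∀ (i k : Fin 3),
        ∑ j, ∑ l, (P a) i j ((Q b) k l ((gameCoeff c j l) • ψ)) = 0) := by
  obtain ⟨e⟩ : Nonempty (QubitLabel ≃ ℕ) := inferInstance
  let φ := (l2Congr e).conjStarAlgEquiv
  let v (p a : Bool) := φ (QubitLabel.extract p a)
  have hv (p : Bool) : IsCoCuntz (v p) := (QubitLabel.isCoCuntz_extract p).map φ
  have hcomm (a b : Bool) : Commute (v true a) (v false b) :=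
    (QubitLabel.commute_extract a b).map φ
  have hproj {p : Bool} (a : Fin 2) (i j : Fin 3) :
      ContinuousLinearMap.adjoint (flipProj (v p) a i j) = flipProj (v p) a j i :=
    congr($(star_flipProj (v p) a) j i)
  refine ⟨l2Congr e (lp.single 2 (none, 0) 1), flipProj (v true), flipProj (v false), ?_,
    fun a => ⟨star_flipProj _ a, (hv _).flipProj_mul_self a⟩,
    fun a => ⟨star_flipProj _ a, (hv _).flipProj_mul_self a⟩,
    flipProj_zero_add_one _, flipProj_zero_add_one _, fun a b i j k l => ⟨?_, ?_⟩,
    fun c a b habc i k => sum_flipProj_flipProj_apply_eq_zero (hv _) (hv _) hcomm ?_ habc i k⟩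
  · rw [LinearIsometryEquiv.norm_map, lp.norm_single (by norm_num), norm_one]
  · exact (hv _).commute_flipProj (hv _) hcomm a b i j k l
  · rw [hproj]
    exact (hv _).commute_flipProj (hv _) hcomm a b j i k l
  · intro a b
    have := congr(l2Congr e $(QubitLabel.extract_extract_single a b))
    simp only [v, φ, LinearIsometryEquiv.conjStarAlgEquiv_apply_apply,
      LinearIsometryEquiv.symm_apply_apply, this]
    split_ifs
    · rw [map_smul]
    · rw [map_zero]
end
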